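/- There exist constants γ ∈ (0,1] and N, depending only on δ, K, and d, such that if L ∈ 𝔏_{δ,K} has coefficients independent of t and u ∈ W²_{d,loc}(B₁) ∩ C(B̄₁), then ∫_{B₁} |Du|^γ dx ≤ N sup_{∂B₁} |u|^γ + N (∫_{B₁} |Lu|^d dx)^{γ/d}. -/

import Mathlib

open MeasureTheory ENNReal Set

noncomputable section

/-- The Frobenius norm of a matrix, used as `|D²u|`. -/
def frobNorm {d : ℕ} (m : Matrix (Fin d) (Fin d) ℝ) : ℝ :=
  Real.sqrt (∑ i, ∑ j, (m i j) ^ 2)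

lemma psd_trace_mul_nonneg {d : ℕ} {A M : Matrix (Fin d) (Fin d) ℝ} (hA : A.PosSemidef)
    (hM : M.PosSemidef) : 0 ≤ (A * M).trace := by
  obtain ⟨B, rfl⟩ : ∃ B : Matrix (Fin d) (Fin d) ℝ, M = B.conjTranspose * B := by
    open scoped MatrixOrder in
    exact CStarAlgebra.nonneg_iff_eq_star_mul_self.1 hM.nonneg
  rw [← Matrix.mul_assoc, Matrix.trace_mul_comm, ← Matrix.mul_assoc]
  exact (hA.mul_mul_conjTranspose_same B).trace_nonneg

lemma psd_det_le {d : ℕ} {M : Matrix (Fin d) (Fin d) ℝ} (hM : M.PosSemidef) :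
    0 ≤ M.det ∧ M.det ≤ M.trace ^ d := by
  refine ⟨hM.det_nonneg, ?_⟩
  have h1 := hM.isHermitian.det_eq_prod_eigenvalues
  have h2 := hM.isHermitian.trace_eq_sum_eigenvalues
  simp only [RCLike.ofReal_real_eq_id, id] at h1 h2
  rw [h1, h2]
  calc _ ≤ ∏ _i : Fin d, ∑ i, hM.isHermitian.eigenvalues i := by
        apply Finset.prod_le_prod
        · intro i _; exact hM.eigenvalues_nonneg i
        · intro i _
          exact Finset.single_le_sum (f := fun i => hM.isHermitian.eigenvalues i)
            (fun j _ => hM.eigenvalues_nonneg j) (Finset.mem_univ i)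
    _ = _ := by simp

lemma det_le_of_elliptic {d : ℕ} {δ : ℝ} (hδ : 0 < δ) {A M : Matrix (Fin d) (Fin d) ℝ}
    (hAs : A.IsSymm)
    (hA : ∀ ξ : EuclideanSpace ℝ (Fin d), δ * ‖ξ‖ ^ 2 ≤ ∑ i, ∑ j, A i j * ξ i * ξ j)
    (hM : M.PosSemidef) :
    0 ≤ ∑ i, ∑ j, A i j * M i j ∧ |M.det| ≤ (δ⁻¹ * ∑ i, ∑ j, A i j * M i j) ^ d := by
  have hAp : (A - δ • (1 : Matrix (Fin d) (Fin d) ℝ)).PosSemidef := by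
    refine Matrix.PosSemidef.of_dotProduct_mulVec_nonneg ?_ ?_
    · apply Matrix.IsHermitian.sub
      · rw [Matrix.IsHermitian, Matrix.conjTranspose_eq_transpose_of_trivial]; exact hAs
      · ext i j; simp [Matrix.one_apply, eq_comm]
    · intro x
      have := hA (WithLp.toLp 2 x)
      rw [EuclideanSpace.norm_sq_eq] at this
      simp only [Real.norm_eq_abs, sq_abs] at this
      simp only [star_trivial, Matrix.sub_mulVec, Matrix.smul_mulVec, Matrix.one_mulVec,
        dotProduct_sub, dotProduct_smul, smul_eq_mul]
      simp only [dotProduct, Matrix.mulVec]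
      have e1 : ∑ i, x i * ∑ j, A i j * x j = ∑ i, ∑ j, A i j * x i * x j := by
        refine Finset.sum_congr rfl fun i _ => ?_
        rw [Finset.mul_sum]
        exact Finset.sum_congr rfl fun j _ => by ring
      have e2 : ∑ i, x i * x i = ∑ i, x i ^ 2 := by simp [sq]
      rw [e1, e2]; linarith
  have ht := psd_trace_mul_nonneg hAp hM
  have e : (A * M).trace = ∑ i, ∑ j, A i j * M i j := by
    simp only [Matrix.trace, Matrix.diag, Matrix.mul_apply]
    refine Finset.sum_congr rfl fun i _ => Finset.sum_congr rfl fun j _ => ?_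
    have := hM.isHermitian.apply i j
    simp at this; rw [this]
  rw [sub_mul, Matrix.trace_sub, e, Matrix.smul_mul, Matrix.one_mul, Matrix.trace_smul,
    smul_eq_mul] at ht
  have hM0 := hM.trace_nonneg
  have hT : M.trace ≤ δ⁻¹ * ∑ i, ∑ j, A i j * M i j := by
    rw [le_inv_mul_iff₀ hδ]; linarith
  obtain ⟨h0, h1⟩ := psd_det_le hM
  refine ⟨by nlinarith, ?_⟩
  rw [abs_of_nonneg h0]
  exact h1.trans (pow_le_pow_left₀ hM0 hT d)

/-- Twice continuously differentiable functions, with gradient and Hessian operator. -/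
structure C2On {d : ℕ} (v : EuclideanSpace ℝ (Fin d) → ℝ)
    (g : EuclideanSpace ℝ (Fin d) → EuclideanSpace ℝ (Fin d))
    (H : EuclideanSpace ℝ (Fin d) → EuclideanSpace ℝ (Fin d) →L[ℝ] EuclideanSpace ℝ (Fin d)) :
    Prop where
  grad : ∀ x, HasGradientAt v (g x) x
  hess : ∀ x, HasFDerivAt g (H x) x
  cont : Continuous H
  symm : ∀ x y z, inner ℝ (H x y) z = inner ℝ y (H x z)

/-- The matrix of an operator in the standard basis. -/
def opMat {d : ℕ} (A : EuclideanSpace ℝ (Fin d) →L[ℝ] EuclideanSpace ℝ (Fin d)) :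
    Matrix (Fin d) (Fin d) ℝ :=
  Matrix.of fun i j => (A (EuclideanSpace.single j 1)) i

/-- Euclidean space. -/
abbrev Eu (d : ℕ) := EuclideanSpace ℝ (Fin d)

section
variable {d : ℕ}

lemma opMat_eq_toMatrix (A : (Eu d) →L[ℝ] (Eu d)) :
    opMat A = LinearMap.toMatrix (EuclideanSpace.basisFun (Fin d) ℝ).toBasis
      (EuclideanSpace.basisFun (Fin d) ℝ).toBasis (A : (Eu d) →ₗ[ℝ] (Eu d)) := by
  ext i j
  simp [opMat, LinearMap.toMatrix_apply]

lemma opMat_det (A : (Eu d) →L[ℝ] (Eu d)) : (opMat A).det = A.det := by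
  rw [opMat_eq_toMatrix, LinearMap.det_toMatrix]

lemma opMat_mulVec (A : (Eu d) →L[ℝ] (Eu d)) (x : Fin d → ℝ) :
    Matrix.mulVec (opMat A) x = (A (WithLp.toLp 2 x)).ofLp := by
  rw [opMat_eq_toMatrix]
  have := LinearMap.toMatrix_mulVec_repr (EuclideanSpace.basisFun (Fin d) ℝ).toBasis
      (EuclideanSpace.basisFun (Fin d) ℝ).toBasis (A : (Eu d) →ₗ[ℝ] (Eu d)) (WithLp.toLp 2 x)
  have e : ∀ y : (Eu d), ⇑((EuclideanSpace.basisFun (Fin d) ℝ).toBasis.repr y) = y.ofLp := by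
    intro y; ext i; simp
  rw [e, e] at this
  exact this

lemma opMat_psd (A : (Eu d) →L[ℝ] (Eu d)) (hs : ∀ y z, inner ℝ (A y) z = inner ℝ y (A z))
    (hp : ∀ y, 0 ≤ inner ℝ y (A y)) : (opMat A).PosSemidef := by
  refine Matrix.PosSemidef.of_dotProduct_mulVec_nonneg ?_ ?_
  · ext i j
    have := hs (EuclideanSpace.single i 1) (EuclideanSpace.single j 1)
    simp [EuclideanSpace.inner_single_left, EuclideanSpace.inner_single_right] at this
    simp [opMat, this]
  · intro x
    have := hp (WithLp.toLp 2 x)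
    rw [opMat_mulVec]
    rw [EuclideanSpace.inner_eq_star_dotProduct] at this
    simpa [dotProduct_comm] using this

lemma opMat_add_smul_id (A : (Eu d) →L[ℝ] (Eu d)) (θ : ℝ) :
    opMat (θ • ContinuousLinearMap.id ℝ (Eu d) + A) = θ • 1 + opMat A := by
  ext i j
  simp [opMat, Matrix.one_apply, eq_comm]

namespace C2On
variable {v : (Eu d) → ℝ} {g : (Eu d) → (Eu d)} {H : (Eu d) → (Eu d) →L[ℝ] (Eu d)}

lemma continuous (h : C2On v g H) : Continuous v :=
  continuous_iff_continuousAt.2 fun x => (h.grad x).hasFDerivAt.continuousAt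

lemma continuous_grad (h : C2On v g H) : Continuous g :=
  continuous_iff_continuousAt.2 fun x => (h.hess x).continuousAt

lemma affine (h : C2On v g H) (κ α β : ℝ) :
    C2On (fun x => κ * v x + α * ‖x‖ ^ 2 + β) (fun x => κ • g x + (2 * α) • x)
      (fun x => κ • H x + (2 * α) • ContinuousLinearMap.id ℝ (Eu d)) where
  grad x := by
    rw [hasGradientAt_iff_hasFDerivAt]
    have h1 := (h.grad x).hasFDerivAt
    have h2 : HasFDerivAt (fun x : (Eu d) => ‖x‖ ^ 2) (2 • innerSL ℝ x) x :=
      (hasStrictFDerivAt_norm_sq x).hasFDerivAt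
    refine (((h1.const_mul κ).add (h2.const_mul α)).add_const β).congr_fderiv ?_
    ext y
    simp [inner_add_left, inner_smul_left]
    ring
  hess x := by
    exact ((h.hess x).const_smul κ).add ((hasFDerivAt_id x).const_smul (2 * α))
  cont := by
    have := h.cont
    fun_prop
  symm x y z := by
    simp [inner_add_left, inner_add_right, inner_smul_left, inner_smul_right, h.symm]

/-- First and second order conditions at a local minimum of `v + θ/2 |· - q|²`. -/
lemma at_min (h : C2On v g H) {θ : ℝ} {z p : (Eu d)}
    (hm : IsLocalMin (fun y => v y + θ / 2 * ‖y‖ ^ 2 - inner ℝ p y) z) :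
    g z = p - θ • z ∧ (opMat (θ • ContinuousLinearMap.id ℝ (Eu d) + H z)).PosSemidef := by
  have hline : ∀ ξ : (Eu d), ∀ t : ℝ, HasDerivAt
      (fun t : ℝ => v (z + t • ξ) + θ / 2 * ‖z + t • ξ‖ ^ 2 - inner ℝ p (z + t • ξ))
      (inner ℝ (g (z + t • ξ)) ξ + θ * inner ℝ (z + t • ξ) ξ - inner ℝ p ξ) t := by
    intro ξ t
    have hl : HasDerivAt (fun t : ℝ => z + t • ξ) ξ t := by
      simpa using ((hasDerivAt_id t).smul_const ξ).const_add z
    have h1 := ((h.grad (z + t • ξ)).hasFDerivAt).comp_hasDerivAt t hl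
    have h2 := ((hasStrictFDerivAt_norm_sq (z + t • ξ)).hasFDerivAt).comp_hasDerivAt t hl
    have h3 := ((innerSL ℝ p).hasFDerivAt (x := z + t • ξ)).comp_hasDerivAt t hl
    refine ((h1.add (h2.const_mul (θ / 2))).sub h3).congr_deriv ?_
    simp [inner_add_left, inner_smul_left]
    ring
  have hmin : ∀ ξ : (Eu d), IsLocalMin
      (fun t : ℝ => v (z + t • ξ) + θ / 2 * ‖z + t • ξ‖ ^ 2 - inner ℝ p (z + t • ξ)) 0 := by
    intro ξ
    have hc : ContinuousAt (fun t : ℝ => z + t • ξ) 0 := by fun_prop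
    have hm' : IsLocalMin (fun y => v y + θ / 2 * ‖y‖ ^ 2 - inner ℝ p y) (z + (0:ℝ) • ξ) := by
      simpa using hm
    exact hc.tendsto.eventually hm'
  refine ⟨?_, opMat_psd _ ?_ ?_⟩
  · refine ext_inner_right ℝ fun ξ => ?_
    have := (hmin ξ).hasDerivAt_eq_zero (hline ξ 0)
    simp only [zero_smul, add_zero] at this
    rw [inner_sub_left, inner_smul_left]
    simp
    linarith
  · intro y x
    simp [inner_add_left, inner_add_right, inner_smul_left, inner_smul_right, h.symm]
  · intro ξ
    set φ := (fun t : ℝ => v (z + t • ξ) + θ / 2 * ‖z + t • ξ‖ ^ 2 - inner ℝ p (z + t • ξ)) with hφ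
    have hd1 : deriv φ = fun t => (inner ℝ (g (z + t • ξ)) ξ + θ * inner ℝ (z + t • ξ) ξ
        - inner ℝ p ξ) := funext fun t => (hline ξ t).deriv
    have hd2 : HasDerivAt (deriv φ) (inner ℝ ξ ((θ • ContinuousLinearMap.id ℝ (Eu d) + H z) ξ)) 0 := by
      rw [hd1]
      have hl : HasDerivAt (fun t : ℝ => z + t • ξ) ξ 0 := by
        simpa using ((hasDerivAt_id (0:ℝ)).smul_const ξ).const_add z
      have hg : HasDerivAt (fun t : ℝ => g (z + t • ξ)) (H z ξ) 0 := by
        refine ((h.hess (z + (0:ℝ) • ξ)).comp_hasDerivAt 0 hl).congr_deriv ?_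
        simp
      have h1 := hg.inner ℝ (hasDerivAt_const (0:ℝ) ξ)
      have h2 := hl.inner ℝ (hasDerivAt_const (0:ℝ) ξ)
      refine ((h1.add (h2.const_mul θ)).sub_const (inner ℝ p ξ)).congr_deriv ?_
      simp [inner_add_right, inner_smul_right, real_inner_comm]
      ring
    by_contra hneg
    push Not at hneg
    have hd0 : deriv φ 0 = 0 := (hmin ξ).deriv_eq_zero
    have hmax : IsLocalMax φ 0 := by
      apply isLocalMax_of_deriv_deriv_neg _ hd0 (hline ξ 0).continuousAt
      rw [hd2.deriv]; exact hneg
    have hconst : φ =ᶠ[nhds 0] fun _ => φ 0 := by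
      filter_upwards [hmax, hmin ξ] with t h1 h2
      exact le_antisymm h1 h2
    have := hconst.deriv.deriv_eq
    rw [hd2.deriv] at this
    rw [this] at hneg
    simp at hneg

lemma measurable_psd (h : C2On v g H) (θ : ℝ) :
    MeasurableSet {z | (opMat (θ • ContinuousLinearMap.id ℝ (Eu d) + H z)).PosSemidef} := by
  have : {z | (opMat (θ • ContinuousLinearMap.id ℝ (Eu d) + H z)).PosSemidef} =
      {z | ∀ y, 0 ≤ inner ℝ y ((θ • ContinuousLinearMap.id ℝ (Eu d) + H z) y)} := by
    ext z
    refine ⟨fun hz y => ?_, fun hz => opMat_psd _ ?_ hz⟩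
    · have := hz.dotProduct_mulVec_nonneg y.ofLp
      rw [opMat_mulVec] at this
      rw [EuclideanSpace.inner_eq_star_dotProduct]
      simpa [dotProduct_comm] using this
    · intro y x
      simp [inner_add_left, inner_add_right, inner_smul_left, inner_smul_right, h.symm]
  rw [this, setOf_forall]
  apply IsClosed.measurableSet
  apply isClosed_iInter
  intro y
  apply isClosed_le continuous_const
  have := h.cont
  fun_prop

lemma volume_image_le (h : C2On v g H) {θ δ : ℝ} (hδ : 0 < δ) (hθ : 0 ≤ θ)
    {S : Set (Eu d)} (hS : MeasurableSet S)
    (hpsd : ∀ z ∈ S, (opMat (θ • ContinuousLinearMap.id ℝ (Eu d) + H z)).PosSemidef)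
    {a : (Eu d) → Matrix (Fin d) (Fin d) ℝ} (has : ∀ x, (a x).IsSymm)
    (ha : ∀ x (ξ : (Eu d)),
          δ * ‖ξ‖ ^ 2 ≤ ∑ i, ∑ j, a x i j * ξ i * ξ j ∧
          ∑ i, ∑ j, a x i j * ξ i * ξ j ≤ δ⁻¹ * ‖ξ‖ ^ 2)
    {G : (Eu d) → ℝ} (hG : ∀ z ∈ S, ∑ i, ∑ j, a z i j * opMat (H z) i j ≤ G z) :
    volume ((fun z => θ • z + g z) '' S) ≤
      ∫⁻ z in S, ENNReal.ofReal ((δ⁻¹ * (θ * d * δ⁻¹ + G z)) ^ d) := by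
  have h1 := addHaar_image_le_lintegral_abs_det_fderiv (volume : Measure (Eu d)) hS
    (f := fun z => θ • z + g z) (f' := fun z => θ • ContinuousLinearMap.id ℝ (Eu d) + H z)
    (fun z _ => (((hasFDerivAt_id z).const_smul θ).add (h.hess z)).hasFDerivWithinAt)
  refine h1.trans (setLIntegral_mono' hS fun z hz => ENNReal.ofReal_le_ofReal ?_)
  obtain ⟨h2, h3⟩ := det_le_of_elliptic hδ (has z) (fun ξ => (ha z ξ).1) (hpsd z hz)
  rw [opMat_det] at h3
  refine h3.trans (pow_le_pow_left₀ (mul_nonneg (inv_nonneg.2 hδ.le) h2) ?_ d)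
  apply mul_le_mul_of_nonneg_left _ (inv_nonneg.2 hδ.le)
  rw [opMat_add_smul_id]
  have e : ∑ i, ∑ j, a z i j * ((θ • (1 : Matrix (Fin d) (Fin d) ℝ) + opMat (H z)) i j) =
      θ * ∑ i, a z i i + ∑ i, ∑ j, a z i j * opMat (H z) i j := by
    simp [Matrix.one_apply, mul_add, Finset.sum_add_distrib, Finset.mul_sum, mul_comm]
  rw [e]
  have htr : ∑ i, a z i i ≤ d * δ⁻¹ := by
    calc ∑ i, a z i i ≤ ∑ _i : Fin d, δ⁻¹ := by
          apply Finset.sum_le_sum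
          intro i _
          have := (ha z (EuclideanSpace.single i 1)).2
          simpa [Pi.single_apply] using this
      _ = _ := by simp
  have := hG z hz
  nlinarith
end C2On
end

section
variable {d : ℕ}

lemma lintegral_affine_pow_le {S : Set (Eu d)} {A B : ℝ} (hA : 0 ≤ A) (hB : 0 ≤ B)
    {f : Eu d → ℝ} (hf : ∀ x, 0 ≤ f x) :
    ∫⁻ z in S, ENNReal.ofReal ((A * (B + f z)) ^ d) ≤
      ENNReal.ofReal ((2 * A) ^ d) *
        (ENNReal.ofReal (B ^ d) * volume S + ∫⁻ z in S, ENNReal.ofReal (f z) ^ d) := by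
  have h1 : ∀ z, ENNReal.ofReal ((A * (B + f z)) ^ d) ≤
      ENNReal.ofReal ((2 * A) ^ d) * (ENNReal.ofReal (B ^ d) + ENNReal.ofReal (f z) ^ d) := by
    intro z
    have hfz := hf z
    rw [← ENNReal.ofReal_pow hfz, ← ENNReal.ofReal_add (by positivity) (by positivity),
      ← ENNReal.ofReal_mul (by positivity)]
    apply ENNReal.ofReal_le_ofReal
    have h2 : (B + f z) ^ d ≤ 2 ^ d * (B ^ d + f z ^ d) := by
      rcases le_total B (f z) with h | h
      · calc (B + f z) ^ d ≤ (2 * f z) ^ d := pow_le_pow_left₀ (by positivity) (by linarith) d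
          _ = 2 ^ d * (f z) ^ d := by rw [mul_pow]
          _ ≤ _ := by
            have : 0 ≤ B ^ d := by positivity
            gcongr; linarith
      · calc (B + f z) ^ d ≤ (2 * B) ^ d := pow_le_pow_left₀ (by positivity) (by linarith) d
          _ = 2 ^ d * B ^ d := by rw [mul_pow]
          _ ≤ _ := by
            have : 0 ≤ f z ^ d := by positivity
            gcongr; linarith
    calc (A * (B + f z)) ^ d = A ^ d * (B + f z) ^ d := by rw [mul_pow]
      _ ≤ A ^ d * (2 ^ d * (B ^ d + f z ^ d)) := by gcongr
      _ = _ := by rw [mul_pow]; ring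
  calc _ ≤ ∫⁻ z in S, ENNReal.ofReal ((2 * A) ^ d) *
        (ENNReal.ofReal (B ^ d) + ENNReal.ofReal (f z) ^ d) := lintegral_mono fun z => h1 z
    _ = _ := by
      rw [lintegral_const_mul' _ _ ENNReal.ofReal_ne_top, lintegral_add_left measurable_const]
      simp

lemma abp_core (hd : 1 ≤ d) {δ K : ℝ} (hδ : 0 < δ) (hK : 0 ≤ K) :
    ∃ C : ℝ, 1 ≤ C ∧ ∀ (a : Eu d → Matrix (Fin d) (Fin d) ℝ) (b : Eu d → Eu d)
      (_ : ∀ x, (a x).IsSymm)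
      (_ : ∀ x (ξ : (Eu d)),
          δ * ‖ξ‖ ^ 2 ≤ ∑ i, ∑ j, a x i j * ξ i * ξ j ∧
          ∑ i, ∑ j, a x i j * ξ i * ξ j ≤ δ⁻¹ * ‖ξ‖ ^ 2)
      (_ : ∀ x, ‖b x‖ ≤ K) (v : Eu d → ℝ) (g : Eu d → Eu d) (H : Eu d → Eu d →L[ℝ] Eu d)
      (_ : C2On v g H) (R : ℝ) (_ : R ≤ 1) (f : Eu d → ℝ) (_ : ∀ x, 0 ≤ f x)
      (_ : ∀ x ∈ Metric.ball 0 R, v x < 0 →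
        ∑ i, ∑ j, a x i j * opMat (H x) i j + inner ℝ (b x) (g x) ≤ f x)
      (_ : ∫⁻ x in Metric.ball 0 R, ENNReal.ofReal (f x) ^ d ≤ 1)
      (_ : ∀ x ∈ Metric.sphere 0 R, 0 ≤ v x),
      ∀ x ∈ Metric.closedBall 0 R, -C ≤ v x := by
  set ω : ℝ := (volume (Metric.ball (0 : Eu d) 1)).toReal with hω
  have hωtop : volume (Metric.ball (0 : Eu d) 1) ≠ ⊤ := measure_ball_lt_top.ne
  have hωpos : 0 < ω := ENNReal.toReal_pos (Metric.measure_ball_pos _ _ one_pos).ne' hωtop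
  obtain ⟨n, hn⟩ := exists_nat_gt (4 * (2 * δ⁻¹) ^ d * K ^ d)
  have hn0 : (0 : ℝ) < n := lt_of_le_of_lt (by positivity) hn
  set C : ℝ := 1 + (2 ^ (n + 1)) ^ d * 4 * (2 * δ⁻¹) ^ d / ω with hC
  have hC1 : 1 ≤ C := by
    rw [hC]; linarith [show 0 ≤ (2 ^ (n + 1)) ^ d * 4 * (2 * δ⁻¹) ^ d / ω by positivity]
  refine ⟨C, hC1, ?_⟩
  intro a b has ha hb v g H hv R hR f hf0 hLv hfint hbd x₀ hx₀
  by_contra hlt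
  push Not at hlt
  set h := -v x₀ with hh
  have hhC : C < h := by linarith
  have hhpos : 0 < h := by linarith
  have hx0n : ‖x₀‖ ≤ R := by simpa using hx₀
  -- contact points
  have hcontact : ∀ p : Eu d, ‖p‖ < h / 2 → ∃ z ∈ Metric.ball (0 : Eu d) R, v z < 0 ∧ g z = p ∧
      (opMat ((0:ℝ) • ContinuousLinearMap.id ℝ (Eu d) + H z)).PosSemidef := by
    intro p hp
    obtain ⟨z, hz, hzmin⟩ := (isCompact_closedBall (0 : Eu d) R).exists_isMinOn ⟨x₀, hx₀⟩
      (f := fun y => v y + (0:ℝ) / 2 * ‖y‖ ^ 2 - inner ℝ p y)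
      (by have := hv.continuous; fun_prop)
    have hzn : ‖z‖ ≤ R := by simpa using hz
    have h1 := isMinOn_iff.1 hzmin x₀ hx₀
    simp only [zero_div, zero_mul, add_zero] at h1
    have hip : ∀ y : Eu d, ‖y‖ ≤ R → |inner ℝ p y| ≤ ‖p‖ := fun y hy =>
      (abs_real_inner_le_norm p y).trans (by nlinarith [norm_nonneg p])
    have h2 := abs_le.1 (hip x₀ hx0n)
    have h3 := abs_le.1 (hip z hzn)
    have hvz : v z < 0 := by linarith
    have hzball : z ∈ Metric.ball (0 : Eu d) R := by
      rcases hzn.lt_or_eq with h | h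
      · simpa using h
      · have := hbd z (by simpa using h)
        linarith
    have hmin := hzmin.isLocalMin (Filter.mem_of_superset (Metric.isOpen_ball.mem_nhds hzball)
      Metric.ball_subset_closedBall)
    obtain ⟨h4, h5⟩ := hv.at_min hmin
    exact ⟨z, hzball, hvz, by simpa using h4, h5⟩
  set ρ : ℕ → ℝ := fun k => h / 2 * (1 / 2) ^ k with hρ
  have hρpos : ∀ k, 0 < ρ k := fun k => by positivity
  have hρle : ∀ k, ρ k ≤ h / 2 := fun k => by
    have : (1 / 2 : ℝ) ^ k ≤ 1 := pow_le_one₀ (by norm_num) (by norm_num)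
    simp only [hρ]; nlinarith
  have hρanti : Antitone ρ := by
    intro i j hij
    simp only [hρ]
    apply mul_le_mul_of_nonneg_left _ (by positivity)
    exact pow_le_pow_of_le_one (by norm_num) (by norm_num) hij
  set A : ℕ → Set (Eu d) := fun k => {p | ρ (k + 1) ≤ ‖p‖ ∧ ‖p‖ < ρ k} with hA
  set S : ℕ → Set (Eu d) := fun k => Metric.ball 0 R ∩ {z | v z < 0} ∩
    {z | (opMat ((0:ℝ) • ContinuousLinearMap.id ℝ (Eu d) + H z)).PosSemidef} ∩ g ⁻¹' (A k) with hS
  have hAm : ∀ k, MeasurableSet (A k) := fun k =>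
    (measurableSet_le measurable_const measurable_norm).inter
      (measurableSet_lt measurable_norm measurable_const)
  have hSm : ∀ k, MeasurableSet (S k) := fun k =>
    ((Metric.isOpen_ball.measurableSet.inter
      (measurableSet_lt hv.continuous.measurable measurable_const)).inter
      (hv.measurable_psd 0)).inter (hv.continuous_grad.measurable (hAm k))
  have hSsub : ∀ k, S k ⊆ Metric.ball 0 R := fun k z hz => hz.1.1.1
  have hSfin : ∀ k, volume (S k) ≠ ⊤ := fun k =>
    ((measure_mono (hSsub k)).trans_lt measure_ball_lt_top).ne
  have hAdisj : ∀ i j, i < j → Disjoint (A i) (A j) := by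
    intro i j hij
    rw [Set.disjoint_left]
    intro p hp1 hp2
    have : ρ j ≤ ρ (i + 1) := hρanti hij
    linarith [hp1.1, hp2.2]
  have hSdisj : Pairwise (Function.onFun Disjoint S) := by
    intro i j hij
    have : Disjoint (A i) (A j) := by
      rcases lt_or_gt_of_ne hij with h | h
      · exact hAdisj i j h
      · exact (hAdisj j i h).symm
    exact (this.preimage g).mono inter_subset_right inter_subset_right
  -- sum of measures
  have hsum : ∑ k ∈ Finset.range n, (volume (S k)).toReal ≤ ω := by
    rw [← ENNReal.toReal_sum (fun k _ => hSfin k), ← measure_biUnion_finset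
      (fun i _ j _ hij => hSdisj hij) (fun k _ => hSm k)]
    apply ENNReal.toReal_mono hωtop
    apply measure_mono
    intro z hz
    simp only [mem_iUnion] at hz
    obtain ⟨k, _, hk⟩ := hz
    exact Metric.ball_subset_ball hR (hSsub k hk)
  obtain ⟨k, hkn, hk⟩ : ∃ k ∈ Finset.range n, (volume (S k)).toReal ≤ ω / n := by
    by_contra hcon
    push Not at hcon
    have hne : (Finset.range n).Nonempty := by
      rw [Finset.nonempty_range_iff]; rintro rfl; simp at hn0
    have := Finset.sum_lt_sum_of_nonempty hne hcon
    simp at this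
    rw [mul_div_cancel₀ _ hn0.ne'] at this
    linarith
  have hkn : k < n := by simpa using hkn
  -- area estimate
  have himg : volume (A k) ≤ volume ((fun z => (0:ℝ) • z + g z) '' (S k)) := by
    apply measure_mono
    intro p hp
    obtain ⟨z, hz1, hz2, hz3, hz4⟩ := hcontact p (hp.2.trans_le (hρle k))
    exact ⟨z, ⟨⟨⟨hz1, hz2⟩, hz4⟩, by simpa [hz3] using hp⟩, by simp [hz3]⟩
  have harea := hv.volume_image_le hδ le_rfl (hSm k) (fun z hz => hz.1.2) has ha
    (G := fun z => K * ρ k + f z) (by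
      intro z hz
      have h1 := hLv z hz.1.1.1 hz.1.1.2
      have h2 := abs_le.1 (abs_real_inner_le_norm (b z) (g z))
      have h3 : ‖g z‖ < ρ k := hz.2.2
      have h4 := hb z
      have : ‖b z‖ * ‖g z‖ ≤ K * ρ k := by
        apply mul_le_mul h4 h3.le (norm_nonneg _) hK
      linarith)
  have hKρ : 0 ≤ K * ρ k := mul_nonneg hK (hρpos k).le
  simp only [zero_mul, zero_add] at harea
  have hbound := (harea.trans (lintegral_affine_pow_le (S := S k) (inv_nonneg.2 hδ.le) hKρ hf0))
  have hVA : volume (A k) ≤ ENNReal.ofReal ((2 * δ⁻¹) ^ d *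
      ((K * ρ k) ^ d * (volume (S k)).toReal + 1)) := by
    refine (himg.trans hbound).trans ?_
    rw [ENNReal.ofReal_mul (by positivity), ENNReal.ofReal_add (by positivity) (by norm_num),
      ENNReal.ofReal_mul (by positivity), ENNReal.ofReal_toReal (hSfin k)]
    gcongr
    refine (lintegral_mono_set (hSsub k)).trans (hfint.trans (by simp))
  have hballs : volume (Metric.ball (0 : Eu d) (ρ k)) ≤
      volume (A k) + volume (Metric.ball (0 : Eu d) (ρ (k + 1))) := by
    refine (measure_mono ?_).trans (measure_union_le _ _)
    intro p hp
    have hp : ‖p‖ < ρ k := by simpa using hp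
    rcases lt_or_ge ‖p‖ (ρ (k + 1)) with h | h
    · right; simpa using h
    · left; exact ⟨h, hp⟩
  rw [Measure.addHaar_ball_of_pos _ _ (hρpos k), Measure.addHaar_ball_of_pos _ _ (hρpos (k+1)),
    finrank_euclideanSpace_fin, ← ENNReal.ofReal_toReal hωtop, ← hω] at hballs
  have hball2 := hballs.trans (add_le_add_left hVA _)
  rw [← ENNReal.ofReal_mul (pow_nonneg (hρpos k).le d),
    ← ENNReal.ofReal_mul (pow_nonneg (hρpos (k+1)).le d),
    ← ENNReal.ofReal_add (by positivity) (mul_nonneg (pow_nonneg (hρpos (k+1)).le d) hωpos.le),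
    ENNReal.ofReal_le_ofReal_iff (by
      have := pow_nonneg (hρpos (k+1)).le d
      positivity)] at hball2
  -- real arithmetic
  have hρk1 : ρ (k + 1) = ρ k / 2 := by simp only [hρ]; rw [pow_succ]; ring
  have hhalf : ρ (k + 1) ^ d ≤ ρ k ^ d / 2 := by
    rw [hρk1, div_pow]
    have : (2:ℝ) ^ 1 ≤ 2 ^ d := pow_le_pow_right₀ (by norm_num) hd
    apply div_le_div_of_nonneg_left (by have := hρpos k; positivity) (by norm_num) (by linarith)
  have hρd : 0 < ρ k ^ d := pow_pos (hρpos k) d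
  set P := ρ k ^ d
  set Q := (2 * δ⁻¹) ^ d with hQ
  have hQ0 : 0 ≤ Q := by positivity
  have hKP : 0 ≤ K ^ d * P := by positivity
  have e1 : (K * ρ k) ^ d * (volume (S k)).toReal ≤ K ^ d * P * (ω / n) := by
    rw [mul_pow]; exact mul_le_mul_of_nonneg_left hk hKP
  have e2 : Q * (K ^ d * P * (ω / n)) ≤ P * ω / 4 := by
    rw [← mul_div_assoc, ← mul_div_assoc, div_le_iff₀ hn0]
    have : 4 * Q * K ^ d * (P * ω) ≤ n * (P * ω) := by gcongr
    nlinarith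
  have e3 : P * ω / 4 ≤ Q := by
    have : ρ (k+1) ^ d * ω ≤ P / 2 * ω := by gcongr
    nlinarith
  have e4 : h / 2 ^ (n + 1) ≤ ρ k := by
    have : ρ n ≤ ρ k := hρanti hkn.le
    refine le_trans (le_of_eq ?_) this
    simp only [hρ]; rw [pow_succ, one_div, inv_pow]; field_simp
  have e5 : (h / 2 ^ (n + 1)) ^ d ≤ P := pow_le_pow_left₀ (by positivity) e4 d
  have e6 : h ^ d ≤ (2 ^ (n + 1)) ^ d * 4 * Q / ω := by
    rw [div_pow, div_le_iff₀ (by positivity)] at e5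
    rw [le_div_iff₀ hωpos]
    have : h ^ d * ω ≤ P * (2 ^ (n + 1)) ^ d * ω := by gcongr
    have h3 : P * ω / 4 * (2 ^ (n + 1)) ^ d ≤ Q * (2 ^ (n + 1)) ^ d := by gcongr
    nlinarith
  have e7 : h ≤ h ^ d := le_self_pow₀ (by linarith) (by omega)
  have : h < C := by rw [hC]; linarith
  linarith
end

/-- `w` is touched from below at `x` by a concave paraboloid of opening `α` and vertex `q`. -/
def Touch {d : ℕ} (w : Eu d → ℝ) (α : ℝ) (x q : Eu d) : Prop :=
  ∀ y, w x + α / 2 * ‖x - q‖ ^ 2 ≤ w y + α / 2 * ‖y - q‖ ^ 2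

/-- The set of points where `w` is touched by a paraboloid of opening `α`. -/
def goodSet {d : ℕ} (w : Eu d → ℝ) (α : ℝ) : Set (Eu d) := {x | ∃ q, Touch w α x q}

section
variable {d : ℕ} {w : Eu d → ℝ} {α : ℝ}

lemma Touch.norm_sq_le (h1 : ∀ x, -1 ≤ w x) (h0 : ∀ x, w x ≤ 0) {x q : Eu d}
    (h : Touch w α x q) : α / 2 * ‖x - q‖ ^ 2 ≤ 1 := by
  have := h q
  simp at this
  linarith [h1 x, h0 q]

lemma Touch.norm_le (hα : 0 < α) (h1 : ∀ x, -1 ≤ w x) (h0 : ∀ x, w x ≤ 0) {x q : Eu d}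
    (h : Touch w α x q) : ‖x - q‖ ≤ Real.sqrt (2 / α) := by
  apply Real.le_sqrt_of_sq_le
  rw [le_div_iff₀ hα]
  linarith [h.norm_sq_le h1 h0]

lemma Touch.eq_of_zero (hα : 0 < α) (h0 : ∀ x, w x ≤ 0) {x q : Eu d}
    (h : Touch w α x q) (hx : w x = 0) : q = x := by
  have := h q
  simp [hx] at this
  have h2 : α / 2 * ‖x - q‖ ^ 2 ≤ 0 := by linarith [h0 q]
  have h3 : ‖x - q‖ ^ 2 ≤ 0 := by
    by_contra hc
    push Not at hc
    have : 0 < α / 2 * ‖x - q‖ ^ 2 := by positivity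
    linarith
  have h4 : ‖x - q‖ = 0 := by nlinarith [norm_nonneg (x - q)]
  exact (sub_eq_zero.1 (norm_eq_zero.1 h4)).symm

lemma goodSet_mono_two (hα : 0 < α) : goodSet w α ⊆ goodSet w (2 * α) := by
  rintro x ⟨q, hq⟩
  refine ⟨x + (1 / 2 : ℝ) • (q - x), fun y => ?_⟩
  have := hq y
  have e1 : x - (x + (1 / 2 : ℝ) • (q - x)) = (1 / 2 : ℝ) • (x - q) := by module
  have e2 : y - (x + (1 / 2 : ℝ) • (q - x)) = (1 / 2 : ℝ) • (x - q) + (y - x) := by module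
  have e3 : y - q = (x - q) + (y - x) := by module
  rw [e1, e2]
  rw [e3] at this
  rw [norm_add_sq_real, norm_smul, inner_smul_left] 
  rw [norm_add_sq_real] at this
  simp only [Real.norm_eq_abs, RCLike.conj_to_real, abs_of_pos (by norm_num : (0:ℝ) < 1/2)]
  nlinarith [sq_nonneg ‖y - x‖]

lemma isClosed_goodSet (hα : 0 < α) (hc : Continuous w) (h1 : ∀ x, -1 ≤ w x)
    (h0 : ∀ x, w x ≤ 0) : IsClosed (goodSet w α) := by
  apply IsSeqClosed.isClosed
  intro x x0 hx hlim
  choose q hq using hx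
  have hb : Bornology.IsBounded (range x) := Metric.isBounded_range_of_tendsto _ hlim
  obtain ⟨M, hM⟩ := hb.exists_norm_le
  have hqb : ∀ n, q n ∈ Metric.closedBall (0 : Eu d) (M + Real.sqrt (2 / α)) := by
    intro n
    have h2 := (hq n).norm_le hα h1 h0
    have h3 := hM (x n) (mem_range_self n)
    have h4 : q n = x n - (x n - q n) := by abel
    have : ‖q n‖ ≤ M + Real.sqrt (2 / α) := by
      rw [h4]; exact (norm_sub_le _ _).trans (add_le_add h3 h2)
    simpa using this
  obtain ⟨q0, -, φ, hφ, hqlim⟩ := tendsto_subseq_of_bounded Metric.isBounded_closedBall hqb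
  refine ⟨q0, fun y => ?_⟩
  have hx2 : Filter.Tendsto (fun n => x (φ n)) Filter.atTop (nhds x0) :=
    hlim.comp hφ.tendsto_atTop
  have hq2 : Filter.Tendsto (fun n => q (φ n)) Filter.atTop (nhds q0) := hqlim
  refine le_of_tendsto_of_tendsto' (b := Filter.atTop) (f := fun n => w (x (φ n)) + α / 2 * ‖x (φ n) - q (φ n)‖ ^ 2)
    (g := fun n => w y + α / 2 * ‖y - q (φ n)‖ ^ 2) ?_ ?_ (fun n => hq (φ n) y)
  · exact ((hc.tendsto x0).comp hx2).add (((hx2.sub hq2).norm.pow 2).const_mul _)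
  · exact tendsto_const_nhds.add (((tendsto_const_nhds.sub hq2).norm.pow 2).const_mul _)

lemma tendsto_quad (hα : 0 < α) (v : Eu d) :
    Filter.Tendsto (fun y : Eu d => -1 + α / 2 * ‖y - v‖ ^ 2) (Filter.cocompact _)
      Filter.atTop := by
  apply Filter.tendsto_atTop_add_const_left
  apply Filter.Tendsto.const_mul_atTop (by positivity)
  refine (Filter.tendsto_pow_atTop two_ne_zero).comp ?_
  exact (tendsto_norm_cocompact_atTop).comp
    (Homeomorph.subRight v).isClosedEmbedding.tendsto_cocompact

lemma exists_touch (hα : 0 < α) (hc : Continuous w) (h1 : ∀ x, -1 ≤ w x) (v : Eu d) :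
    ∃ z, Touch w α z v := by
  obtain ⟨z, hz⟩ := Continuous.exists_forall_le (f := fun y => w y + α / 2 * ‖y - v‖ ^ 2)
    (by fun_prop) (Filter.tendsto_atTop_mono (fun y => by linarith [h1 y]) (tendsto_quad hα v))
  exact ⟨z, hz⟩

/-- The Moreau-type envelope. -/
lemma exists_envelope (hα : 0 < α) (hc : Continuous w) (h1 : ∀ x, -1 ≤ w x)
    (h0 : ∀ x, w x ≤ 0) : ∃ m : Eu d → ℝ, Continuous m ∧ (∀ v, m v ≤ 0) ∧
      (∀ v y, m v ≤ w y + α / 2 * ‖y - v‖ ^ 2) ∧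
      ∀ z q, Touch w α z q → m q = w z + α / 2 * ‖z - q‖ ^ 2 := by
  choose z hz using fun v => exists_touch hα hc h1 v
  set m : Eu d → ℝ := fun v => w (z v) + α / 2 * ‖z v - v‖ ^ 2 with hm
  set r := Real.sqrt (2 / α) with hr
  have hr0 : 0 ≤ r := Real.sqrt_nonneg _
  have hkey : ∀ v v', m v - m v' ≤ α / 2 * (2 * r * ‖v - v'‖ + ‖v - v'‖ ^ 2) := by
    intro v v'
    have h2 := hz v (z v')
    have h3 := (hz v').norm_le hα h1 h0
    have h4 : ‖z v' - v‖ ≤ ‖z v' - v'‖ + ‖v - v'‖ := by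
      have : z v' - v = (z v' - v') - (v - v') := by abel
      rw [this]; exact norm_sub_le _ _
    have h5 : ‖z v' - v‖ ^ 2 ≤ ‖z v' - v'‖ ^ 2 + (2 * r * ‖v - v'‖ + ‖v - v'‖ ^ 2) := by
      nlinarith [norm_nonneg (z v' - v), norm_nonneg (v - v'), norm_nonneg (z v' - v')]
    simp only [hm]
    have h6 : α / 2 * ‖z v' - v‖ ^ 2 ≤
      α / 2 * (‖z v' - v'‖ ^ 2 + (2 * r * ‖v - v'‖ + ‖v - v'‖ ^ 2)) := by gcongr
    linarith
  refine ⟨m, ?_, ?_, fun v y => hz v y, ?_⟩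
  · rw [continuous_iff_continuousAt]
    intro v'
    rw [ContinuousAt, tendsto_iff_dist_tendsto_zero]
    have hlim : Filter.Tendsto (fun v => α / 2 * (2 * r * ‖v - v'‖ + ‖v - v'‖ ^ 2)) (nhds v')
        (nhds 0) := by
      have : Continuous fun v : Eu d => α / 2 * (2 * r * ‖v - v'‖ + ‖v - v'‖ ^ 2) := by fun_prop
      simpa using this.tendsto v'
    refine squeeze_zero (fun _ => dist_nonneg) (fun v => ?_) hlim
    rw [Real.dist_eq, abs_le]
    have e1 := hkey v v'
    have e2 := hkey v' v
    rw [norm_sub_rev v' v] at e2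
    constructor <;> linarith
  · intro v
    have := hz v v
    simp at this
    exact this.trans (h0 v)
  · intro y q hyq
    exact le_antisymm (hz q y) (hyq (z q))

/-- A maximal monotone selection. -/
lemma exists_selection (hα : 0 < α) (hc : Continuous w) (h1 : ∀ x, -1 ≤ w x)
    (h0 : ∀ x, w x ≤ 0) : ∃ Q : Eu d → Eu d,
      (∀ x y, 0 ≤ inner ℝ (x - y) (Q x - Q y)) ∧
      ∀ x z q, Touch w α z q → 0 ≤ inner ℝ (x - z) (Q x - q) := by
  obtain ⟨m, hmc, hm0, hmle, hmt⟩ := exists_envelope hα hc h1 h0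
  have hex : ∀ x, ∃ q, ∀ v, m v - α / 2 * ‖v - x‖ ^ 2 ≤ m q - α / 2 * ‖q - x‖ ^ 2 := by
    intro x
    obtain ⟨q, hq⟩ := Continuous.exists_forall_le (f := fun v => -m v + α / 2 * ‖v - x‖ ^ 2)
      (by fun_prop) (Filter.tendsto_atTop_mono (fun y => by linarith [hm0 y]) (tendsto_quad hα x))
    exact ⟨q, fun v => by linarith [hq v]⟩
  have hmono : ∀ x y p q, (∀ v, m v - α / 2 * ‖v - x‖ ^ 2 ≤ m p - α / 2 * ‖p - x‖ ^ 2) →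
      (∀ v, m v - α / 2 * ‖v - y‖ ^ 2 ≤ m q - α / 2 * ‖q - y‖ ^ 2) →
      0 ≤ inner ℝ (x - y) (p - q) := by
    intro x y p q hp hq
    have e1 := hp q
    have e2 := hq p
    have e3 : ‖p - x‖ ^ 2 + ‖q - y‖ ^ 2 ≤ ‖q - x‖ ^ 2 + ‖p - y‖ ^ 2 := by
      have : 0 ≤ α / 2 * ((‖q - x‖ ^ 2 + ‖p - y‖ ^ 2) - (‖p - x‖ ^ 2 + ‖q - y‖ ^ 2)) := by
        linarith
      have := nonneg_of_mul_nonneg_right this (by positivity)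
      linarith
    rw [norm_sub_sq_real, norm_sub_sq_real, norm_sub_sq_real, norm_sub_sq_real] at e3
    rw [inner_sub_left, inner_sub_right, inner_sub_right, real_inner_comm p x, real_inner_comm q x,
      real_inner_comm p y, real_inner_comm q y]
    linarith
  choose Q hQ using hex
  refine ⟨Q, fun x y => hmono x y _ _ (hQ x) (hQ y), fun x z q hzq => hmono x z _ _ (hQ x) ?_⟩
  intro v
  have e1 := hmle v z
  have e2 := hmt z q hzq
  rw [norm_sub_rev z] at e1 e2
  linarith

lemma Touch.at_neg {v : Eu d → ℝ} {g : Eu d → Eu d} {H : Eu d → Eu d →L[ℝ] Eu d}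
    (hv : C2On v g H) {z q : Eu d} (hzq : Touch w α z q) (hw : w =ᶠ[nhds z] v) :
    g z = α • (q - z) ∧ (opMat (α • ContinuousLinearMap.id ℝ (Eu d) + H z)).PosSemidef := by
  have hm : IsLocalMin (fun y => v y + α / 2 * ‖y‖ ^ 2 - inner ℝ (α • q) y) z := by
    filter_upwards [hw] with y hy
    have h1 := hzq y
    rw [norm_sub_sq_real, norm_sub_sq_real, hy, hw.self_of_nhds] at h1
    rw [inner_smul_left, inner_smul_left, real_inner_comm y q, real_inner_comm z q]
    simp only [RCLike.conj_to_real]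
    linarith
  obtain ⟨h1, h2⟩ := hv.at_min hm
  exact ⟨by rw [h1, smul_sub], h2⟩

end

section
variable {d : ℕ}

lemma volume_le_of_antilip {Φ : Eu d → Eu d} (h : AntilipschitzWith 2 Φ) (s : Set (Eu d)) :
    volume s ≤ 2 ^ d * volume (Φ '' s) := by
  have h1 := h.le_hausdorffMeasure_image (d := d) (Nat.cast_nonneg d) s
  rw [← EuclideanSpace.euclideanHausdorffMeasure_eq_volume,
    MeasureTheory.Measure.euclideanHausdorffMeasure_def]
  simp only [Measure.smul_apply, ENNReal.smul_def, smul_eq_mul]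
  rw [mul_left_comm]
  gcongr
  simpa using h1

open scoped Pointwise in
lemma decay_step {δ K : ℝ} (hδ : 0 < δ) (hK : 0 ≤ K)
    {a : Eu d → Matrix (Fin d) (Fin d) ℝ} {b : Eu d → Eu d}
    (has : ∀ x, (a x).IsSymm)
    (ha : ∀ x (ξ : (Eu d)),
          δ * ‖ξ‖ ^ 2 ≤ ∑ i, ∑ j, a x i j * ξ i * ξ j ∧
          ∑ i, ∑ j, a x i j * ξ i * ξ j ≤ δ⁻¹ * ‖ξ‖ ^ 2)
    (hb : ∀ x, ‖b x‖ ≤ K) {v : Eu d → ℝ} {g : Eu d → Eu d} {H : Eu d → Eu d →L[ℝ] Eu d}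
    (hv : C2On v g H) {R : ℝ} {f : Eu d → ℝ} (hf : ∀ x, 0 ≤ f x)
    {w : Eu d → ℝ} (hc : Continuous w) (h1 : ∀ x, -1 ≤ w x) (h0 : ∀ x, w x ≤ 0)
    (hw : ∀ z, w z < 0 → z ∈ Metric.ball 0 R ∧ w =ᶠ[nhds z] v)
    (hL : ∀ z, w z < 0 → ∑ i, ∑ j, a z i j * opMat (H z) i j + inner ℝ (b z) (g z) ≤ f z)
    {α : ℝ} (hα : 1 ≤ α) :
    volume (goodSet w α)ᶜ ≤ 2 ^ d * (volume ((goodSet w α)ᶜ ∩ goodSet w (2 * α)) +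
      ENNReal.ofReal ((2 * δ⁻¹) ^ d) *
        (ENNReal.ofReal ((d * δ⁻¹ + 2 * K) ^ d) *
          volume ((goodSet w α)ᶜ ∩ goodSet w (2 * α)) +
          ENNReal.ofReal (((2 * α)⁻¹) ^ d) *
            ∫⁻ x in Metric.ball 0 R, ENNReal.ofReal (f x) ^ d)) := by
  have hα0 : 0 < α := by linarith
  set β := 2 * α with hβ
  have hβ0 : 0 < β := by positivity
  have hβ1 : 1 ≤ β := by linarith
  obtain ⟨Q, hQ1, hQ2⟩ := exists_selection hα0 hc h1 h0
  set Φ : Eu d → Eu d := fun x => (1 / 2 : ℝ) • (x + Q x) with hΦ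
  have hanti : AntilipschitzWith 2 Φ := by
    apply AntilipschitzWith.of_le_mul_dist
    intro x y
    rw [dist_eq_norm, dist_eq_norm]
    have e1 : Φ x - Φ y = (1 / 2 : ℝ) • ((x - y) + (Q x - Q y)) := by
      simp only [hΦ]; module
    rw [e1, norm_smul]
    have e2 : ‖x - y‖ ^ 2 ≤ ‖(x - y) + (Q x - Q y)‖ ^ 2 := by
      rw [norm_add_sq_real]
      nlinarith [hQ1 x y, sq_nonneg ‖Q x - Q y‖]
    have e3 : ‖x - y‖ ≤ ‖(x - y) + (Q x - Q y)‖ := by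
      exact le_of_sq_le_sq e2 (norm_nonneg _) 
    simpa using e3
  set F := (goodSet w α)ᶜ with hF
  set E := F ∩ goodSet w β with hE
  set S := E ∩ {z | w z < 0} ∩
    {z | (opMat (β • ContinuousLinearMap.id ℝ (Eu d) + H z)).PosSemidef} ∩
    {z | ‖g z‖ ≤ 2 * β} with hS
  have hEm : MeasurableSet E := (isClosed_goodSet hα0 hc h1 h0).measurableSet.compl.inter
    (isClosed_goodSet hβ0 hc h1 h0).measurableSet
  have hSm : MeasurableSet S := ((hEm.inter (measurableSet_lt hc.measurable measurable_const)).inter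
    (hv.measurable_psd β)).inter
      (measurableSet_le hv.continuous_grad.norm.measurable measurable_const)
  have himg : Φ '' F ⊆ E ∪ β⁻¹ • ((fun z => β • z + g z) '' S) := by
    rintro _ ⟨x0, hx0, rfl⟩
    obtain ⟨z, hz⟩ := exists_touch hβ0 hc h1 (Φ x0)
    -- `z ∈ F`
    have hzF : z ∈ F := by
      rintro ⟨q, hq⟩
      have hmid : Φ x0 = (1 / 2 : ℝ) • (z + q) := by
        rcases (h0 z).lt_or_eq with hneg | hzero
        · have e1 := (hq.at_neg hv (hw z hneg).2).1
          have e2 := (hz.at_neg hv (hw z hneg).2).1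
          rw [e1, hβ, mul_comm, mul_smul] at e2
          have e3 := smul_right_injective (Eu d) hα0.ne' e2
          have : (2:ℝ) • Φ x0 = z + q := by
            have e4 : q = z + (2:ℝ) • (Φ x0 - z) := by rw [← e3]; abel
            rw [e4]; module
          rw [← this]; module
        · rw [hq.eq_of_zero hα0 h0 hzero, hz.eq_of_zero hβ0 h0 hzero]
          module
      have e5 : x0 + Q x0 = z + q := by
        have := smul_right_injective (Eu d) (by norm_num : (1/2:ℝ) ≠ 0) hmid
        exact this
      have e6 : Q x0 - q = -(x0 - z) := by
        have : Q x0 = z + q - x0 := by rw [← e5]; abel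
        rw [this]; abel
      have e7 := hQ2 x0 z q hq
      rw [e6, inner_neg_right, real_inner_self_eq_norm_sq] at e7
      have e8 : ‖x0 - z‖ = 0 := by nlinarith [norm_nonneg (x0 - z)]
      have e9 : x0 = z := sub_eq_zero.1 (norm_eq_zero.1 e8)
      exact hx0 ⟨q, e9 ▸ hq⟩
    have hzE : z ∈ E := ⟨hzF, ⟨_, hz⟩⟩
    rcases (h0 z).lt_or_eq with hneg | hzero
    · right
      obtain ⟨e1, e2⟩ := hz.at_neg hv (hw z hneg).2
      rw [Set.mem_smul_set]
      refine ⟨_, ⟨z, ⟨⟨⟨hzE, hneg⟩, e2⟩, ?_⟩, rfl⟩, ?_⟩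
      · have e3 := hz.norm_sq_le h1 h0
        rw [mem_setOf_eq, e1, norm_smul, Real.norm_eq_abs, abs_of_pos hβ0, norm_sub_rev]
        have : ‖z - Φ x0‖ ≤ 2 := by
          by_contra hcon
          push Not at hcon
          nlinarith
        nlinarith
      · simp only [e1]
        rw [← smul_add, smul_smul, inv_mul_cancel₀ hβ0.ne']
        module
    · left
      rw [hz.eq_of_zero hβ0 h0 hzero]
      exact hzE
  have hSball : S ⊆ Metric.ball 0 R := fun z hz => (hw z hz.1.1.2).1
  have hSE : S ⊆ E := fun z hz => hz.1.1.1
  have harea := hv.volume_image_le hδ hβ0.le hSm (fun z hz => hz.1.2) has ha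
    (G := fun z => K * (2 * β) + f z) (by
      intro z hz
      have h1 := hL z hz.1.1.2
      have h2 := abs_le.1 (abs_real_inner_le_norm (b z) (g z))
      have : ‖b z‖ * ‖g z‖ ≤ K * (2 * β) := mul_le_mul (hb z) hz.2 (norm_nonneg _) hK
      linarith)
  have hbound := lintegral_affine_pow_le (S := S) (inv_nonneg.2 hδ.le)
    (B := β * (d * δ⁻¹ + 2 * K)) (by positivity) hf
  have harea2 : volume ((fun z => β • z + g z) '' S) ≤ ENNReal.ofReal ((2 * δ⁻¹) ^ d) *
        (ENNReal.ofReal ((β * (d * δ⁻¹ + 2 * K)) ^ d) * volume S +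
          ∫⁻ z in S, ENNReal.ofReal (f z) ^ d) := by
    refine (harea.trans (le_of_eq ?_)).trans hbound
    congr 1; ext z; congr 3; ring
  have hscale : volume (β⁻¹ • ((fun z => β • z + g z) '' S)) ≤ ENNReal.ofReal ((2 * δ⁻¹) ^ d) *
        (ENNReal.ofReal ((d * δ⁻¹ + 2 * K) ^ d) * volume E +
          ENNReal.ofReal ((β⁻¹) ^ d) * ∫⁻ x in Metric.ball 0 R, ENNReal.ofReal (f x) ^ d) := by
    rw [Measure.addHaar_smul, finrank_euclideanSpace_fin, abs_of_pos (by positivity)]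
    refine (mul_le_mul_right harea2 _).trans ?_
    have hle : ENNReal.ofReal (β⁻¹ ^ d) * ENNReal.ofReal ((β * (d * δ⁻¹ + 2 * K)) ^ d) =
        ENNReal.ofReal ((d * δ⁻¹ + 2 * K) ^ d) := by
      rw [← ENNReal.ofReal_mul (by positivity), ← mul_pow, inv_mul_cancel_left₀ hβ0.ne']
    rw [mul_left_comm, mul_add, ← mul_assoc (ENNReal.ofReal (β⁻¹ ^ d)), hle]
    gcongr
  calc volume F ≤ 2 ^ d * volume (Φ '' F) := volume_le_of_antilip hanti F
    _ ≤ 2 ^ d * (volume E + volume (β⁻¹ • ((fun z => β • z + g z) '' S))) := by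
      gcongr
      exact (measure_mono himg).trans (measure_union_le _ _)
    _ ≤ _ := by gcongr

lemma bad_subset_ball {w : Eu d → ℝ} {R : ℝ} (hR : R ≤ 1) (h1 : ∀ x, -1 ≤ w x)
    (h0 : ∀ x, w x ≤ 0) (hw : ∀ z, w z < 0 → z ∈ Metric.ball (0 : Eu d) R) :
    (goodSet w 1)ᶜ ⊆ Metric.ball 0 3 := by
  intro x hx
  by_contra hcon
  have hx3 : 3 ≤ ‖x‖ := by simpa using hcon
  apply hx
  refine ⟨x, fun y => ?_⟩
  simp only [sub_self, norm_zero]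
  have := h0 x
  rcases (h0 y).lt_or_eq with h | h
  · have hy : ‖y‖ < R := by simpa using hw y h
    have h2 : 2 ≤ ‖y - x‖ := by
      have := norm_sub_norm_le x y
      rw [norm_sub_rev] at this
      linarith
    nlinarith [h1 y]
  · rw [h]
    have : 0 ≤ ‖y - x‖ ^ 2 := by positivity
    linarith

lemma real_decay {C1 C2 V0 : ℝ} (hC1 : 2 ≤ C1) (hC2 : 0 ≤ C2) {V : ℕ → ℝ}
    (hV0 : V 0 ≤ V0) (hV00 : 0 ≤ V0)
    (hstep : ∀ k, V k ≤ C1 * (V k - V (k+1)) + C2 * (1/2) ^ (k+1)) (k : ℕ) :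
    V k ≤ (V0 + C1 * C2 + 1) * (1 - 1 / (2 * C1)) ^ k := by
  have hC10 : 0 < C1 := by linarith
  have hθ : (1:ℝ)/2 ≤ 1 - 1 / (2 * C1) := by
    have : 1 / (2 * C1) ≤ 1 / 4 := by
      apply one_div_le_one_div_of_le <;> linarith
    linarith
  induction k with
  | zero => simp; have : 0 ≤ C1 * C2 := by positivity
            linarith
  | succ k ih =>
    set θ := 1 - 1 / (2 * C1) with hθd
    set C := V0 + C1 * C2 + 1
    have h1 := hstep k
    have h2 : (1/2:ℝ) ^ k ≤ θ ^ k := pow_le_pow_left₀ (by norm_num) hθ k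
    have h3 : C1 * V (k+1) ≤ (C1 - 1) * V k + C2 * (1/2) ^ (k+1) := by linarith
    have h4 : (C1 - 1) * V k ≤ (C1 - 1) * (C * θ ^ k) := by
      apply mul_le_mul_of_nonneg_left ih; linarith
    have h5 : C2 * (1/2) ^ (k+1) ≤ C2 / 2 * θ ^ k := by
      rw [pow_succ]; nlinarith
    have h6 : C1 * θ = C1 - 1 / 2 := by rw [hθd]; field_simp
    have hθk : 0 < θ ^ k := by
      have : 0 < θ := by linarith
      positivity
    have h7 : C2 ≤ C := by
      have : C2 ≤ C1 * C2 := by nlinarith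
      simp only [C]; linarith
    have h8 : C1 * V (k+1) ≤ C1 * (C * θ ^ (k+1)) := by
      calc C1 * V (k+1) ≤ (C1 - 1) * (C * θ ^ k) + C2 / 2 * θ ^ k := by linarith
        _ ≤ (C1 - 1) * (C * θ ^ k) + C / 2 * θ ^ k := by gcongr
        _ = (C1 - 1/2) * (C * θ ^ k) := by ring
        _ = C1 * (C * θ ^ (k+1)) := by rw [← h6, pow_succ]; ring
    exact le_of_mul_le_mul_left h8 hC10

lemma decay (hd : 1 ≤ d) {δ K : ℝ} (hδ : 0 < δ) (hK : 0 ≤ K) {Cf : ℝ} (hCf : 0 ≤ Cf) :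
    ∃ C θ : ℝ, 0 < C ∧ 1 / 2 ≤ θ ∧ θ < 1 ∧
    ∀ (a : Eu d → Matrix (Fin d) (Fin d) ℝ) (b : Eu d → Eu d)
    (_ : ∀ x, (a x).IsSymm)
    (_ : ∀ x (ξ : (Eu d)),
          δ * ‖ξ‖ ^ 2 ≤ ∑ i, ∑ j, a x i j * ξ i * ξ j ∧
          ∑ i, ∑ j, a x i j * ξ i * ξ j ≤ δ⁻¹ * ‖ξ‖ ^ 2)
    (_ : ∀ x, ‖b x‖ ≤ K) (v : Eu d → ℝ) (g : Eu d → Eu d) (H : Eu d → Eu d →L[ℝ] Eu d)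
    (_ : C2On v g H) (R : ℝ) (_ : R ≤ 1) (f : Eu d → ℝ) (_ : ∀ x, 0 ≤ f x)
    (w : Eu d → ℝ) (_ : Continuous w) (_ : ∀ x, -1 ≤ w x) (_ : ∀ x, w x ≤ 0)
    (_ : ∀ z, w z < 0 → z ∈ Metric.ball 0 R ∧ w =ᶠ[nhds z] v)
    (_ : ∀ z, w z < 0 → ∑ i, ∑ j, a z i j * opMat (H z) i j + inner ℝ (b z) (g z) ≤ f z)
    (_ : ∫⁻ x in Metric.ball 0 R, ENNReal.ofReal (f x) ^ d ≤ ENNReal.ofReal Cf) (k : ℕ),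
    volume (goodSet w (2 ^ k))ᶜ ≤ ENNReal.ofReal (C * θ ^ k) := by
  set M := (2 * δ⁻¹) ^ d with hM
  set M' := (d * δ⁻¹ + 2 * K) ^ d with hM'
  have hM0 : 0 ≤ M := by positivity
  have hM'0 : 0 ≤ M' := by positivity
  set C1 : ℝ := 2 ^ d * (1 + M * M') with hC1
  set C2 : ℝ := 2 ^ d * M * Cf with hC2
  set V0 := (volume (Metric.ball (0 : Eu d) 3)).toReal with hV0
  have h2d : (2:ℝ) ≤ 2 ^ d := by
    calc (2:ℝ) = 2 ^ 1 := by norm_num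
      _ ≤ 2 ^ d := pow_le_pow_right₀ (by norm_num) hd
  have hC12 : 2 ≤ C1 := by
    have : 0 ≤ M * M' := by positivity
    rw [hC1]; nlinarith
  have hC20 : 0 ≤ C2 := by positivity
  have hV00 : 0 ≤ V0 := ENNReal.toReal_nonneg
  refine ⟨V0 + C1 * C2 + 1, 1 - 1 / (2 * C1), by positivity, ?_, ?_, ?_⟩
  · have : 1 / (2 * C1) ≤ 1 / 4 := by
      apply one_div_le_one_div_of_le <;> linarith
    linarith
  · have : 0 < 1 / (2 * C1) := by positivity
    linarith
  intro a b has ha hb v g H hv R hR f hf w hc h1 h0 hw hL hInteg k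
  have hsub : ∀ k : ℕ, (goodSet w (2 ^ (k+1)))ᶜ ⊆ (goodSet w (2 ^ k))ᶜ := by
    intro k
    apply compl_subset_compl.2
    rw [pow_succ, mul_comm]
    exact goodSet_mono_two (by positivity)
  have hsub0 : ∀ k : ℕ, (goodSet w (2 ^ k))ᶜ ⊆ Metric.ball 0 3 := by
    intro k
    induction k with
    | zero => simpa using bad_subset_ball hR h1 h0 (fun z hz => (hw z hz).1)
    | succ k ih => exact (hsub k).trans ih
  have hfin : ∀ k : ℕ, volume (goodSet w (2 ^ k))ᶜ ≠ ⊤ := fun k =>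
    ((measure_mono (hsub0 k)).trans_lt measure_ball_lt_top).ne
  set V : ℕ → ℝ := fun k => (volume (goodSet w (2 ^ k))ᶜ).toReal with hV
  have hstep : ∀ k, V k ≤ C1 * (V k - V (k+1)) + C2 * (1/2) ^ (k+1) := by
    intro k
    have hα : (1:ℝ) ≤ 2 ^ k := one_le_pow₀ (by norm_num)
    have hs := decay_step hδ hK has ha hb hv hf hc h1 h0 hw hL hα
    have e1 : (2:ℝ) * 2 ^ k = 2 ^ (k+1) := by rw [pow_succ]; ring
    rw [e1] at hs
    have e2 : (goodSet w (2 ^ k))ᶜ ∩ goodSet w (2 ^ (k+1)) =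
      (goodSet w (2 ^ k))ᶜ \ (goodSet w (2 ^ (k+1)))ᶜ := by
      rw [diff_eq, compl_compl]
    have e3 : volume ((goodSet w (2 ^ k))ᶜ ∩ goodSet w (2 ^ (k+1))) =
        ENNReal.ofReal (V k - V (k+1)) := by
      rw [e2, measure_diff (hsub k)
        ((isClosed_goodSet (by positivity) hc h1 h0).measurableSet.compl.nullMeasurableSet)
        (hfin (k+1)), ENNReal.ofReal_sub _ ENNReal.toReal_nonneg, ENNReal.ofReal_toReal (hfin k),
        ENNReal.ofReal_toReal (hfin (k+1))]
    have hVnn : 0 ≤ V k - V (k+1) := by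
      rw [sub_nonneg]
      exact ENNReal.toReal_mono (hfin k) (measure_mono (hsub k))
    rw [e3, ← ENNReal.ofReal_toReal (hfin k)] at hs
    have hs2 : ENNReal.ofReal (V k) ≤ ENNReal.ofReal (2 ^ d * ((V k - V (k+1)) +
      M * (M' * (V k - V (k+1)) + ((2 ^ (k+1))⁻¹) ^ d * Cf))) := by
      refine hs.trans ?_
      rw [ENNReal.ofReal_mul (by positivity), ENNReal.ofReal_add hVnn (by positivity),
        ENNReal.ofReal_mul hM0, ENNReal.ofReal_add (by positivity) (by positivity),
        ENNReal.ofReal_mul hM'0, ENNReal.ofReal_mul (by positivity),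
        ENNReal.ofReal_pow (by norm_num : (0:ℝ) ≤ 2)]
      simp only [ENNReal.ofReal_ofNat]
      gcongr
    rw [ENNReal.ofReal_le_ofReal_iff (by positivity)] at hs2
    have e4 : (((2:ℝ) ^ (k+1))⁻¹) ^ d ≤ (1/2) ^ (k+1) := by
      rw [← inv_pow, one_div]
      apply pow_le_of_le_one (by positivity) _ (by omega)
      apply pow_le_one₀ <;> norm_num
    have e5 : 2 ^ d * M * Cf * (((2:ℝ) ^ (k+1))⁻¹) ^ d ≤ C2 * (1/2) ^ (k+1) := by
      rw [hC2]; gcongr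
    rw [hC1]
    nlinarith
  have hfinal := real_decay hC12 hC20 (V := V) (V0 := V0)
    (ENNReal.toReal_mono measure_ball_lt_top.ne (measure_mono (hsub0 0))) hV00 hstep k
  rw [← ENNReal.ofReal_toReal (hfin k)]
  exact ENNReal.ofReal_le_ofReal hfinal
end

section
variable {d : ℕ}

lemma exists_gamma {θ : ℝ} (hθ0 : 0 < θ) (hθ1 : θ < 1) :
    ∃ γ : ℝ, γ ∈ Set.Ioc (0:ℝ) 1 ∧ (4:ℝ) ^ γ * θ < 1 := by
  have hc : Filter.Tendsto (fun γ : ℝ => (4:ℝ) ^ γ * θ) (nhdsWithin 0 (Set.Ioi 0)) (nhds θ) := by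
    have : Continuous fun γ : ℝ => (4:ℝ) ^ γ * θ :=
      (Real.continuous_const_rpow (by norm_num)).mul continuous_const
    have h := this.tendsto 0
    simp at h
    exact h.mono_left nhdsWithin_le_nhds
  have h1 := hc.eventually (gt_mem_nhds hθ1)
  have h2 : ∀ᶠ γ : ℝ in nhdsWithin 0 (Set.Ioi 0), γ ∈ Set.Ioo (0:ℝ) 1 :=
    Ioo_mem_nhdsGT one_pos
  obtain ⟨γ, h3, h4⟩ := (h1.and h2).exists
  exact ⟨γ, ⟨h4.1, h4.2.le⟩, h3⟩

lemma layer {X : Type*} [MeasurableSpace X] {μ : Measure X} {h : X → ℝ} (hm : Measurable h)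
    {γ θ Λ C ω : ℝ} (hγ : 0 < γ) (hθ : 0 < θ) (hγθ : (4:ℝ) ^ γ * θ < 1) (hΛ : 0 < Λ)
    (hC : 0 ≤ C) (hω : 0 ≤ ω) (hμ : μ univ ≤ ENNReal.ofReal ω)
    (hk : ∀ k : ℕ, μ {x | Λ * 4 ^ k ≤ h x} ≤ ENNReal.ofReal (C * θ ^ k)) :
    ∫⁻ x, ENNReal.ofReal (h x) ^ γ ∂μ ≤
      ENNReal.ofReal (Λ ^ γ * ω + (Λ * 4) ^ γ * C * (1 - 4 ^ γ * θ)⁻¹) := by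
  set r := (4:ℝ) ^ γ * θ with hr
  have hr0 : 0 ≤ r := by positivity
  set E : ℕ → Set X := fun k => {x | Λ * 4 ^ k ≤ h x} with hE
  have hEm : ∀ k, MeasurableSet (E k) := fun k => measurableSet_le measurable_const hm
  have hpt : ∀ x, ENNReal.ofReal (h x) ^ γ ≤ ENNReal.ofReal (Λ ^ γ) +
      ∑' k, (E k).indicator (fun _ => ENNReal.ofReal ((Λ * 4 ^ (k+1)) ^ γ)) x := by
    intro x
    rcases le_total (h x) Λ with hx | hx
    · refine le_trans ?_ le_self_add
      rw [← ENNReal.ofReal_rpow_of_pos hΛ]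
      gcongr
    · obtain ⟨n, h1, h2⟩ := exists_nat_pow_near (x := h x / Λ) (y := 4)
        ((one_le_div hΛ).2 hx) (by norm_num)
      rw [le_div_iff₀ hΛ, mul_comm] at h1
      rw [div_lt_iff₀ hΛ, mul_comm] at h2
      refine le_trans ?_ le_add_self
      refine le_trans ?_ (ENNReal.le_tsum n)
      rw [indicator_of_mem (show x ∈ E n from h1), ← ENNReal.ofReal_rpow_of_pos (by positivity)]
      gcongr
  refine (lintegral_mono hpt).trans ?_
  rw [lintegral_add_left measurable_const, lintegral_const,
    lintegral_tsum (fun k => (measurable_const.indicator (hEm k)).aemeasurable)]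
  have h1r : 0 < 1 - r := by linarith
  rw [ENNReal.ofReal_add (by positivity) (by positivity), ENNReal.ofReal_mul (by positivity)]
  gcongr ?_ + ?_
  · gcongr
  · have hterm : ∀ k, ∫⁻ x, (E k).indicator (fun _ => ENNReal.ofReal ((Λ * 4 ^ (k+1)) ^ γ)) x ∂μ ≤
        ENNReal.ofReal ((Λ * 4) ^ γ * C * r ^ k) := by
      intro k
      rw [lintegral_indicator_const (hEm k)]
      refine (mul_le_mul_right (hk k) _).trans (le_of_eq ?_)
      rw [← ENNReal.ofReal_mul (by positivity)]
      congr 1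
      have h4 : ((4:ℝ) ^ k) ^ γ = ((4:ℝ) ^ γ) ^ k := by
        rw [← Real.rpow_natCast, ← Real.rpow_mul (by norm_num), mul_comm,
          Real.rpow_mul_natCast (by norm_num)]
      have e : Λ * (4:ℝ) ^ (k + 1) = (Λ * 4) * 4 ^ k := by rw [pow_succ]; ring
      rw [e, Real.mul_rpow (by positivity) (by positivity), h4, hr, mul_pow]
      ring
    refine (ENNReal.tsum_le_tsum hterm).trans (le_of_eq ?_)
    rw [← ENNReal.ofReal_tsum_of_nonneg (fun k => by positivity)
      ((summable_geometric_of_lt_one hr0 hγθ).mul_left _), tsum_mul_left,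
      tsum_geometric_of_lt_one hr0 hγθ]

lemma pow_sub_pow_le_mul {x y : ℝ} (hx : 0 ≤ x) (hxy : x ≤ y) (hy : y ≤ 1) (n : ℕ) :
    y ^ n - x ^ n ≤ n * (y - x) := by
  induction n with
  | zero => simp
  | succ n ih =>
    have h1 : x ^ n ≤ 1 := pow_le_one₀ hx (by linarith)
    have h2 : x ^ n ≤ y ^ n := pow_le_pow_left₀ hx hxy n
    push_cast
    rw [pow_succ, pow_succ]
    have h3 : (y ^ n - x ^ n) * y ≤ y ^ n - x ^ n := by nlinarith
    have h4 : x ^ n * (y - x) ≤ y - x := by nlinarith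
    nlinarith

lemma volume_annulus_le {R s : ℝ} (hs : 0 ≤ s) (hsR : s < R) (hR : R ≤ 1) :
    volume (Metric.ball (0 : Eu d) R \ Metric.ball 0 (R - s)) ≤
      ENNReal.ofReal ((volume (Metric.ball (0 : Eu d) 1)).toReal * d * s) := by
  have hωtop : volume (Metric.ball (0 : Eu d) 1) ≠ ⊤ := measure_ball_lt_top.ne
  rw [measure_diff (Metric.ball_subset_ball (by linarith))
    Metric.isOpen_ball.measurableSet.nullMeasurableSet measure_ball_lt_top.ne,
    Measure.addHaar_ball_of_pos _ _ (by linarith : 0 < R),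
    Measure.addHaar_ball_of_pos _ _ (by linarith : 0 < R - s), finrank_euclideanSpace_fin]
  generalize volume (Metric.ball (0 : Eu d) 1) = W at *
  lift W to NNReal using hωtop
  rw [ENNReal.coe_toReal, ← ENNReal.ofReal_coe_nnreal]
  have h1 : 0 ≤ R - s := by linarith
  have h0R : 0 ≤ R := by linarith
  rw [← ENNReal.ofReal_mul (by positivity), ← ENNReal.ofReal_mul (by positivity),
    ← ENNReal.ofReal_sub _ (by positivity)]
  apply ENNReal.ofReal_le_ofReal
  have := pow_sub_pow_le_mul h1 (by linarith : R - s ≤ R) hR d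
  have h2 : 0 ≤ (W : ℝ) := W.coe_nonneg
  have h3 := mul_le_mul_of_nonneg_left this h2
  simp only [_root_.sub_sub_cancel] at h3
  linarith

lemma opMat_affine (A : Eu d →L[ℝ] Eu d) (κ t : ℝ) (i j : Fin d) :
    opMat (κ • A + t • ContinuousLinearMap.id ℝ (Eu d)) i j =
      κ * opMat A i j + t * (1 : Matrix (Fin d) (Fin d) ℝ) i j := by
  simp [opMat, Matrix.one_apply, eq_comm]

lemma trace_le {δ : ℝ} {a : Matrix (Fin d) (Fin d) ℝ}
    (ha : ∀ (ξ : (Eu d)),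
          δ * ‖ξ‖ ^ 2 ≤ ∑ i, ∑ j, a i j * ξ i * ξ j ∧
          ∑ i, ∑ j, a i j * ξ i * ξ j ≤ δ⁻¹ * ‖ξ‖ ^ 2) :
    ∑ i, ∑ j, a i j * (1 : Matrix (Fin d) (Fin d) ℝ) i j ≤ d * δ⁻¹ := by
  have h1 : ∀ i, a i i ≤ δ⁻¹ := by
    intro i
    have := (ha (EuclideanSpace.single i 1)).2
    simpa [Pi.single_apply] using this
  calc ∑ i, ∑ j, a i j * (1 : Matrix (Fin d) (Fin d) ℝ) i j = ∑ i, a i i := by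
        simp [Matrix.one_apply]
    _ ≤ ∑ i : Fin d, δ⁻¹ := Finset.sum_le_sum fun i _ => h1 i
    _ = d * δ⁻¹ := by simp

lemma sum_affine (a : Matrix (Fin d) (Fin d) ℝ) (A : Eu d →L[ℝ] Eu d) (κ t : ℝ) :
    ∑ i, ∑ j, a i j * opMat (κ • A + t • ContinuousLinearMap.id ℝ (Eu d)) i j =
      κ * (∑ i, ∑ j, a i j * opMat A i j) +
      t * ∑ i, ∑ j, a i j * (1 : Matrix (Fin d) (Fin d) ℝ) i j := by
  simp only [opMat_affine, Finset.mul_sum, ← Finset.sum_add_distrib]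
  congr 1; ext i; congr 1; ext j; ring

/-- Two sided maximum principle. -/
lemma max_principle (hd : 1 ≤ d) {δ K : ℝ} (hδ : 0 < δ) (hK : 0 ≤ K) :
    ∃ C : ℝ, 1 ≤ C ∧ ∀ (a : Eu d → Matrix (Fin d) (Fin d) ℝ) (b : Eu d → Eu d) (c : Eu d → ℝ)
      (_ : ∀ x, (a x).IsSymm)
      (_ : ∀ x (ξ : (Eu d)),
          δ * ‖ξ‖ ^ 2 ≤ ∑ i, ∑ j, a x i j * ξ i * ξ j ∧
          ∑ i, ∑ j, a x i j * ξ i * ξ j ≤ δ⁻¹ * ‖ξ‖ ^ 2)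
      (_ : ∀ x, ‖b x‖ ≤ K) (_ : ∀ x, 0 ≤ c x)
      (v : Eu d → ℝ) (g : Eu d → Eu d) (H : Eu d → Eu d →L[ℝ] Eu d)
      (_ : C2On v g H) (R : ℝ) (_ : R ≤ 1)
      (_ : ∫⁻ x in Metric.ball 0 R, ENNReal.ofReal
        |∑ i, ∑ j, a x i j * opMat (H x) i j + inner ℝ (b x) (g x) - c x * v x| ^ d ≤ 1)
      (_ : ∀ x ∈ Metric.sphere 0 R, |v x| ≤ 1),
      ∀ x ∈ Metric.closedBall 0 R, |v x| ≤ C := by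
  obtain ⟨C, hC1, hC⟩ := abp_core hd hδ hK
  refine ⟨C + 1, by linarith, ?_⟩
  intro a b c has ha hb hc v g H hv R hR hInteg hbd x hx
  have key : ∀ κ : ℝ, κ = 1 ∨ κ = -1 → -C ≤ κ * v x + 0 * ‖x‖ ^ 2 + 1 := by
    intro κ hκ
    have hκ2 : κ * κ = 1 := by rcases hκ with h | h <;> rw [h] <;> norm_num
    have hκa : |κ| = 1 := by rcases hκ with h | h <;> rw [h] <;> norm_num
    refine hC a b has ha hb _ _ _ (hv.affine κ 0 1) R hR _ (fun _ => abs_nonneg _) ?_ hInteg ?_ x hx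
    · intro y hy hneg
      rw [sum_affine]
      simp only [mul_zero, zero_smul, add_zero, zero_mul, inner_smul_right] at hneg ⊢
      set T := ∑ i, ∑ j, a y i j * opMat (H y) i j
      have h1 : κ * (T + inner ℝ (b y) (g y) - c y * v y) ≤
          |T + inner ℝ (b y) (g y) - c y * v y| := by
        refine (le_abs_self _).trans (le_of_eq ?_)
        rw [abs_mul, hκa, one_mul]
      have h2 : c y * (κ * v y) ≤ 0 := mul_nonpos_of_nonneg_of_nonpos (hc y) (by linarith)
      linarith
    · intro y hy
      have h1 := hbd y hy
      have h2 : |κ * v y| ≤ 1 := by rw [abs_mul, hκa, one_mul]; exact h1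
      linarith [(abs_le.1 h2).1]
  have h1 := key 1 (Or.inl rfl)
  have h2 := key (-1) (Or.inr rfl)
  rw [abs_le]
  constructor <;> linarith
end

section
variable {d : ℕ}

set_option maxHeartbeats 2000000 in
lemma smooth_est (hd : 1 ≤ d) {δ K : ℝ} (hδ : 0 < δ) (hK : 0 ≤ K) :
    ∃ γ N : ℝ, γ ∈ Set.Ioc (0:ℝ) 1 ∧ 0 < N ∧
      ∀ (a : Eu d → Matrix (Fin d) (Fin d) ℝ) (b : Eu d → Eu d) (c : Eu d → ℝ)
      (_ : ∀ x, (a x).IsSymm)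
      (_ : ∀ x (ξ : (Eu d)),
          δ * ‖ξ‖ ^ 2 ≤ ∑ i, ∑ j, a x i j * ξ i * ξ j ∧
          ∑ i, ∑ j, a x i j * ξ i * ξ j ≤ δ⁻¹ * ‖ξ‖ ^ 2)
      (_ : ∀ x, ‖b x‖ + c x ≤ K) (_ : ∀ x, 0 ≤ c x)
      (v : Eu d → ℝ) (g : Eu d → Eu d) (H : Eu d → Eu d →L[ℝ] Eu d)
      (_ : C2On v g H) (R : ℝ) (_ : 1 / 2 ≤ R) (_ : R ≤ 1)
      (_ : ∫⁻ x in Metric.ball 0 R, ENNReal.ofReal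
        |∑ i, ∑ j, a x i j * opMat (H x) i j + inner ℝ (b x) (g x) - c x * v x| ^ d ≤ 1)
      (_ : ∀ x ∈ Metric.sphere 0 R, |v x| ≤ 1),
      ∫⁻ x in Metric.ball 0 R, ENNReal.ofReal ‖g x‖ ^ γ ≤ ENNReal.ofReal N := by
  obtain ⟨C0, hC01, hmax⟩ := max_principle hd hδ hK
  set ω : ℝ := (volume (Metric.ball (0 : Eu d) 1)).toReal with hω
  have hωtop : volume (Metric.ball (0 : Eu d) 1) ≠ ⊤ := measure_ball_lt_top.ne
  have hω0 : 0 ≤ ω := ENNReal.toReal_nonneg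
  set B : ℝ := 3 * K + 2 * (d * δ⁻¹) with hB
  have hB0 : 0 ≤ B := by positivity
  set Cf : ℝ := 2 ^ d * (B ^ d * ω + 1) with hCf
  obtain ⟨C, θ, hC0, hθ2, hθ1, hdecay⟩ := decay hd hδ hK (Cf := Cf) (by positivity)
  have hθ0 : 0 < θ := by linarith
  obtain ⟨γ, hγ, hγθ⟩ := exists_gamma hθ0 hθ1
  set Λ : ℝ := 65 * C0 with hΛ
  have hC00 : 0 < C0 := by linarith
  have hΛ0 : 0 < Λ := by positivity
  set C' : ℝ := C + ω * d with hC'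
  refine ⟨γ, Λ ^ γ * ω + (Λ * 4) ^ γ * C' * (1 - 4 ^ γ * θ)⁻¹ + 1, hγ, ?_, ?_⟩
  · have : 0 < 1 - 4 ^ γ * θ := by linarith
    positivity
  intro a b c has ha hbc hc v g H hv R hR2 hR1 hInteg hbd
  have hb : ∀ x, ‖b x‖ ≤ K := fun x => by linarith [hbc x, hc x]
  have hcK : ∀ x, c x ≤ K := fun x => by linarith [hbc x, norm_nonneg (b x)]
  have hvC := hmax a b c has ha hb hc v g H hv R hR1 hInteg hbd
  set Lv : Eu d → ℝ := fun x =>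
    |∑ i, ∑ j, a x i j * opMat (H x) i j + inner ℝ (b x) (g x) - c x * v x| with hLv
  have hball : volume (Metric.ball (0 : Eu d) R) ≤ ENNReal.ofReal ω := by
    rw [hω, ENNReal.ofReal_toReal hωtop]
    exact measure_mono (Metric.ball_subset_ball hR1)
  refine (layer (μ := volume.restrict (Metric.ball 0 R)) hv.continuous_grad.norm.measurable hγ.1
    hθ0 hγθ hΛ0 (C := C') (by positivity) hω0 (by simpa using hball) ?_).trans
    (ENNReal.ofReal_le_ofReal (by linarith))
  intro k
  -- the main distributional estimate
  set s : ℝ := (1/2) ^ k / 4 with hs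
  have hpk : 0 < ((1:ℝ)/2) ^ k := by positivity
  have hpk1 : ((1:ℝ)/2) ^ k ≤ 1 := pow_le_one₀ (by norm_num) (by norm_num)
  have hs0 : 0 < s := by positivity
  have hs4 : s ≤ 1 / 4 := by rw [hs]; linarith
  set κ : ℝ := s / (4 * C0) with hκ
  have hκ0 : 0 < κ := by positivity
  have hκC : κ * C0 = s / 4 := by rw [hκ]; field_simp
  have hκ1 : κ ≤ 1 := by nlinarith
  set β : ℝ := κ * C0 - R ^ 2 with hβ
  set ũ : Eu d → ℝ := fun x => κ * v x + 1 * ‖x‖ ^ 2 + β with hũ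
  have hũC := hv.affine κ 1 β
  have hũc : Continuous ũ := hũC.continuous
  have hκv : ∀ x ∈ Metric.closedBall (0 : Eu d) R, -(κ * C0) ≤ κ * v x ∧ κ * v x ≤ κ * C0 := by
    intro x hx
    have := abs_le.1 (hvC x hx)
    constructor <;> nlinarith
  set w : Eu d → ℝ := fun x => if ‖x‖ ≤ R then min (ũ x) 0 else 0 with hw
  have hsph : ∀ x : Eu d, ‖x‖ = R → 0 ≤ ũ x := by
    intro x hx
    have := (hκv x (by simp [hx])).1
    simp only [hũ, hx, hβ]; linarith
  have hwc : Continuous w := by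
    apply Continuous.if_le (by fun_prop) continuous_const continuous_norm continuous_const
    intro x hx
    exact min_eq_right (hsph x hx)
  have hw0 : ∀ x, w x ≤ 0 := by
    intro x
    simp only [hw]
    split_ifs
    · exact min_le_right _ _
    · exact le_rfl
  have hw1 : ∀ x, -1 ≤ w x := by
    intro x
    simp only [hw]
    split_ifs with h
    · apply le_min _ (by norm_num)
      have := (hκv x (by simpa using h)).1
      simp only [hũ, hβ]
      nlinarith [sq_nonneg ‖x‖]
    · norm_num
  have hwneg : ∀ z, w z < 0 → z ∈ Metric.ball (0 : Eu d) R ∧ ũ z < 0 := by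
    intro z hz
    simp only [hw] at hz
    split_ifs at hz with h
    · have h2 : ũ z < 0 := by
        by_contra hcon
        push Not at hcon
        rw [min_eq_right hcon] at hz
        exact lt_irrefl _ hz
      refine ⟨?_, h2⟩
      rcases h.lt_or_eq with h3 | h3
      · simpa using h3
      · linarith [hsph z h3]
    · exact absurd hz (lt_irrefl _)
  have hwloc : ∀ z, w z < 0 → z ∈ Metric.ball (0 : Eu d) R ∧ w =ᶠ[nhds z] ũ := by
    intro z hz
    obtain ⟨h1, h2⟩ := hwneg z hz
    refine ⟨h1, ?_⟩
    filter_upwards [Metric.isOpen_ball.mem_nhds h1, (isOpen_lt hũc continuous_const).mem_nhds h2]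
      with y hy1 hy2
    have hy3 : ‖y‖ ≤ R := by
      have : ‖y‖ < R := by simpa using hy1
      exact this.le
    simp only [hw, if_pos hy3]
    exact min_eq_left (le_of_lt hy2)
  have hin : ∀ x ∈ Metric.ball (0 : Eu d) (R - s), w x < 0 := by
    intro x hx
    have hx1 : ‖x‖ < R - s := by simpa using hx
    have hxR : ‖x‖ ≤ R := by linarith
    have := (hκv x (by simpa using hxR)).2
    simp only [hw, if_pos hxR]
    apply min_lt_of_left_lt
    simp only [hũ, hβ]
    nlinarith [norm_nonneg x]
  have hLw : ∀ z, w z < 0 →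
      ∑ i, ∑ j, a z i j * opMat (κ • H z + (2 * 1 : ℝ) • ContinuousLinearMap.id ℝ (Eu d)) i j +
        inner ℝ (b z) (κ • g z + (2 * 1 : ℝ) • z) ≤ B + Lv z := by
    intro z hz
    have hzb := (hwneg z hz).1
    have hzn : ‖z‖ < R := by simpa using hzb
    rw [sum_affine, inner_add_right, inner_smul_right, inner_smul_right]
    have h1 := trace_le (ha z)
    have h2 := (abs_le.1 (abs_real_inner_le_norm (b z) z)).2
    have h3 : ‖b z‖ * ‖z‖ ≤ K * 1 := mul_le_mul (hb z) (by linarith) (norm_nonneg _) hK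
    have h4 := (hκv z (Metric.ball_subset_closedBall hzb)).2
    set T := ∑ i, ∑ j, a z i j * opMat (H z) i j
    have h5 : T + inner ℝ (b z) (g z) - c z * v z ≤ Lv z := le_abs_self _
    have h6 : κ * (T + inner ℝ (b z) (g z) - c z * v z) ≤ Lv z := by
      have h9 : 0 ≤ Lv z := abs_nonneg _
      calc _ ≤ κ * Lv z := mul_le_mul_of_nonneg_left h5 hκ0.le
        _ ≤ 1 * Lv z := mul_le_mul_of_nonneg_right hκ1 h9
        _ = Lv z := one_mul _
    have h7 : c z * (κ * v z) ≤ K := by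
      have : c z * (κ * v z) ≤ c z * (κ * C0) := mul_le_mul_of_nonneg_left h4 (hc z)
      have h8 : c z * (κ * C0) ≤ K * 1 := by
        apply mul_le_mul (hcK z) _ (by positivity) hK
        rw [hκC]; linarith
      linarith
    rw [hB]
    linarith
  have hfint : ∫⁻ x in Metric.ball (0 : Eu d) R, ENNReal.ofReal (B + Lv x) ^ d ≤
      ENNReal.ofReal Cf := by
    have h1 := lintegral_affine_pow_le (S := Metric.ball (0 : Eu d) R) (A := 1) (by norm_num) hB0
      (f := Lv) (fun x => abs_nonneg _)
    have h2 : ∀ x, ENNReal.ofReal (B + Lv x) ^ d = ENNReal.ofReal ((1 * (B + Lv x)) ^ d) := by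
      intro x
      have : 0 ≤ Lv x := abs_nonneg _
      rw [one_mul, ENNReal.ofReal_pow (by positivity)]
    simp only [h2]
    refine h1.trans ?_
    rw [hCf, ENNReal.ofReal_mul (by positivity), ENNReal.ofReal_add (by positivity) (by norm_num),
      ENNReal.ofReal_mul (by positivity), mul_one, ENNReal.ofReal_one]
    gcongr
  have hdk := hdecay a b has ha hb _ _ _ hũC R hR1 (fun x => B + Lv x)
    (fun x => add_nonneg hB0 (abs_nonneg _)) w hwc hw1 hw0 hwloc hLw hfint k
  have hann := volume_annulus_le (d := d) hs0.le (by linarith : s < R) hR1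
  have hsub : {x | Λ * 4 ^ k ≤ ‖g x‖} ∩ Metric.ball 0 R ⊆
      (goodSet w (2 ^ k))ᶜ ∪ (Metric.ball (0 : Eu d) R \ Metric.ball 0 (R - s)) := by
    rintro x ⟨hx1, hx2⟩
    by_cases hxs : x ∈ Metric.ball (0 : Eu d) (R - s)
    · left
      rintro ⟨q, hq⟩
      have hneg := hin x hxs
      have hg := (hq.at_neg hũC (hwloc x hneg).2).1
      have hqn := hq.norm_sq_le hw1 hw0
      have h2k : (1:ℝ) ≤ 2 ^ k := one_le_pow₀ (by norm_num)
      have hxq : ‖x - q‖ ≤ 2 := by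
        by_contra hcon
        push Not at hcon
        nlinarith
      have hxn : ‖x‖ ≤ 1 := by
        have : ‖x‖ < R := by simpa using hx2
        linarith
      have e1 : κ • g x = (2 ^ k : ℝ) • (q - x) - (2 * 1 : ℝ) • x := by
        rw [← hg]; abel
      have e2 : κ * ‖g x‖ ≤ 4 * 2 ^ k := by
        have : ‖κ • g x‖ = κ * ‖g x‖ := by rw [norm_smul, Real.norm_eq_abs, abs_of_pos hκ0]
        rw [← this, e1]
        refine (norm_sub_le _ _).trans ?_
        rw [norm_smul, norm_smul, norm_sub_rev q x]
        simp only [norm_pow, Real.norm_ofNat, mul_one]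
        nlinarith
      have e3 : κ * (64 * C0 * 4 ^ k) = 4 * 2 ^ k := by
        have h22 : ((1:ℝ)/2) ^ k * 4 ^ k = 2 ^ k := by rw [← mul_pow]; norm_num
        calc κ * (64 * C0 * 4 ^ k) = κ * C0 * 64 * 4 ^ k := by ring
          _ = 4 * (((1:ℝ)/2) ^ k * 4 ^ k) := by rw [hκC, hs]; ring
          _ = _ := by rw [h22]
      have e4 : ‖g x‖ ≤ 64 * C0 * 4 ^ k := by
        rw [← e3] at e2
        exact le_of_mul_le_mul_left e2 hκ0
      have e5 : Λ * 4 ^ k ≤ ‖g x‖ := hx1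
      have e6 : 0 < C0 * 4 ^ k := by positivity
      rw [hΛ] at e5
      nlinarith
    · right; exact ⟨hx2, hxs⟩
  rw [Measure.restrict_apply (measurableSet_le measurable_const hv.continuous_grad.norm.measurable)]
  refine (measure_mono hsub).trans ((measure_union_le _ _).trans ((add_le_add hdk hann).trans ?_))
  rw [← ENNReal.ofReal_add (by positivity) (by positivity)]
  apply ENNReal.ofReal_le_ofReal
  have h1 : s ≤ θ ^ k := by
    have : ((1:ℝ)/2) ^ k ≤ θ ^ k := pow_le_pow_left₀ (by norm_num) hθ2 k
    rw [hs]; linarith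
  have h2 : ω * d * s ≤ ω * d * θ ^ k := by gcongr
  rw [hC']; linarith
end

section
variable {d : ℕ}

lemma tendsto_translation {W : Eu d → ℝ} {p : ℝ≥0∞} [hp1 : Fact (1 ≤ p)] (hp : p ≠ ⊤)
    (hW : MemLp W p volume) :
    Filter.Tendsto (fun t : Eu d => eLpNorm (fun x => W (x - t) - W x) p volume) (nhds 0)
      (nhds 0) := by
  let g : Eu d → C(Eu d, Eu d) := fun t => ⟨fun x => x - t, by fun_prop⟩
  have hg : Continuous g := by
    apply ContinuousMap.continuous_of_continuous_uncurry
    change Continuous fun q : Eu d × Eu d => q.2 - q.1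
    fun_prop
  have hgm : ∀ t, MeasurePreserving (g t) (volume : Measure (Eu d)) volume := fun t =>
    measurePreserving_sub_right volume t
  have hcont := Continuous.compMeasurePreservingLp (f := fun _ : Eu d => hW.toLp W)
    continuous_const hg hgm hp
  have h0 := (hcont.tendsto 0)
  rw [tendsto_iff_edist_tendsto_0] at h0
  refine h0.congr fun t => ?_
  have e0 : (Lp.compMeasurePreserving (g 0) (hgm 0) (hW.toLp W)) = hW.toLp W := by
    rw [Lp.toLp_compMeasurePreserving]
    congr 1
    ext x; simp [g]
  rw [e0, Lp.toLp_compMeasurePreserving, Lp.edist_toLp_toLp]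
  rfl

lemma jensen_conv (φ : ContDiffBump (0 : Eu d)) {W : Eu d → ℝ} (hWm : Measurable W)
    (hWl : LocallyIntegrable W volume) (hd : 1 ≤ d) (x : Eu d) :
    ‖(convolution (φ.normed volume) W (ContinuousLinearMap.lsmul ℝ ℝ) volume) x - W x‖ₑ ^ (d:ℝ) ≤
      ∫⁻ t, ENNReal.ofReal (φ.normed volume t) * ‖W (x - t) - W x‖ₑ ^ (d:ℝ) := by
  set ψ := φ.normed (volume : Measure (Eu d)) with hψ
  have hψc : Continuous ψ := φ.continuous_normed
  have hψ0 : ∀ t, 0 ≤ ψ t := fun t => φ.nonneg_normed t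
  have hψi : Integrable ψ volume := φ.integrable_normed
  have hInteg : Integrable (fun t => ψ t • W (x - t)) volume :=
    (φ.hasCompactSupport_normed (μ := volume)).convolutionExists_left
      (ContinuousLinearMap.lsmul ℝ ℝ) hψc hWl x
  have e1 : (convolution ψ W (ContinuousLinearMap.lsmul ℝ ℝ) volume) x - W x =
      ∫ t, ψ t • (W (x - t) - W x) := by
    have h1 : ∫ t, ψ t • W x = W x := φ.integral_normed_smul volume (W x)
    rw [convolution_def]
    simp only [smul_sub]
    rw [integral_sub hInteg (hψi.smul_const _), h1]
    rfl
  set ν : Measure (Eu d) := volume.withDensity (fun t => ENNReal.ofReal (ψ t)) with hν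
  have hψm : Measurable fun t => ENNReal.ofReal (ψ t) := hψc.measurable.ennreal_ofReal
  haveI : IsProbabilityMeasure ν := by
    refine ⟨?_⟩
    rw [hν, withDensity_apply _ MeasurableSet.univ, Measure.restrict_univ,
      ← ofReal_integral_eq_lintegral_ofReal hψi (Filter.Eventually.of_forall hψ0),
      φ.integral_normed, ENNReal.ofReal_one]
  have hhm : Measurable fun t => W (x - t) - W x := by fun_prop
  have hhm2 : Measurable fun t => ‖W (x - t) - W x‖ₑ := hhm.enorm
  have h2 : ‖∫ t, ψ t • (W (x - t) - W x)‖ₑ ≤ eLpNorm (fun t => W (x - t) - W x) 1 ν := by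
    refine (enorm_integral_le_lintegral_enorm _).trans (le_of_eq ?_)
    rw [eLpNorm_one_eq_lintegral_enorm, hν, lintegral_withDensity_eq_lintegral_mul _ hψm hhm2]
    congr 1; ext t
    rw [Pi.mul_apply, enorm_smul, Real.enorm_of_nonneg (hψ0 t)]
  have hd' : (1 : ℝ≥0∞) ≤ (d : ℝ≥0∞) := by exact_mod_cast hd
  have hd0 : (d : ℝ≥0∞) ≠ 0 := (lt_of_lt_of_le one_pos hd').ne'
  have h3 := eLpNorm_le_eLpNorm_of_exponent_le (μ := ν) hd' hhm.aestronglyMeasurable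
  rw [e1]
  have hdr : (0:ℝ) < d := by exact_mod_cast hd
  refine (ENNReal.rpow_le_rpow (h2.trans h3) hdr.le).trans (le_of_eq ?_)
  rw [eLpNorm_eq_lintegral_rpow_enorm_toReal hd0 (ENNReal.natCast_ne_top d), ENNReal.toReal_natCast,
    ← ENNReal.rpow_mul, one_div_mul_cancel hdr.ne', ENNReal.rpow_one, hν,
    lintegral_withDensity_eq_lintegral_mul _ hψm (hhm2.pow_const _)]
  rfl

lemma tendsto_conv_Lp (hd : 1 ≤ d) {φ : ℕ → ContDiffBump (0 : Eu d)}
    (hφ : Filter.Tendsto (fun n => (φ n).rOut) Filter.atTop (nhds 0)) {W : Eu d → ℝ}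
    (hWm : Measurable W) (hW : MemLp W d volume) :
    Filter.Tendsto (fun n => eLpNorm (fun x => (convolution ((φ n).normed volume) W
      (ContinuousLinearMap.lsmul ℝ ℝ) volume) x - W x) d volume) Filter.atTop (nhds 0) := by
  have hd' : (1 : ℝ≥0∞) ≤ (d : ℝ≥0∞) := by exact_mod_cast hd
  have hd0 : (d : ℝ≥0∞) ≠ 0 := (lt_of_lt_of_le one_pos hd').ne'
  have hdr : (0:ℝ) < d := by exact_mod_cast hd
  haveI : Fact ((1 : ℝ≥0∞) ≤ (d : ℝ≥0∞)) := ⟨hd'⟩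
  have htr := tendsto_translation (ENNReal.natCast_ne_top d) hW
  rw [ENNReal.tendsto_nhds_zero] at htr ⊢
  intro ε hε
  obtain ⟨r, hr, hrε⟩ := Metric.eventually_nhds_iff_ball.1 (htr ε hε)
  filter_upwards [hφ.eventually (gt_mem_nhds hr)] with n hn
  have hWl : LocallyIntegrable W volume := hW.locallyIntegrable hd'
  set ψ := (φ n).normed (volume : Measure (Eu d)) with hψ
  have hψc : Continuous ψ := (φ n).continuous_normed
  have hψ0 : ∀ t, 0 ≤ ψ t := fun t => (φ n).nonneg_normed t
  have hψi : Integrable ψ volume := (φ n).integrable_normed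
  rw [eLpNorm_eq_lintegral_rpow_enorm_toReal hd0 (ENNReal.natCast_ne_top d), ENNReal.toReal_natCast,
    one_div, ENNReal.rpow_inv_le_iff hdr]
  calc ∫⁻ x, ‖(convolution ψ W (ContinuousLinearMap.lsmul ℝ ℝ) volume) x - W x‖ₑ ^ (d:ℝ)
      ≤ ∫⁻ x, ∫⁻ t, ENNReal.ofReal (ψ t) * ‖W (x - t) - W x‖ₑ ^ (d:ℝ) :=
        lintegral_mono fun x => jensen_conv (φ n) hWm hWl hd x
    _ = ∫⁻ t, ∫⁻ x, ENNReal.ofReal (ψ t) * ‖W (x - t) - W x‖ₑ ^ (d:ℝ) := by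
        apply lintegral_lintegral_swap
        apply Measurable.aemeasurable
        have : Measurable fun q : Eu d × Eu d => W (q.1 - q.2) - W q.1 := by fun_prop
        exact ((hψc.measurable.comp measurable_snd).ennreal_ofReal).mul (this.enorm.pow_const _)
    _ ≤ ∫⁻ t, ENNReal.ofReal (ψ t) * ε ^ (d:ℝ) := by
        apply lintegral_mono
        intro t
        have hm : Measurable fun x => W (x - t) - W x := by fun_prop
        simp only
        rw [lintegral_const_mul _ (hm.enorm.pow_const _)]
        by_cases ht : t ∈ Metric.ball (0 : Eu d) (φ n).rOut
        · gcongr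
          have h1 := hrε t (Metric.ball_subset_ball hn.le ht)
          rw [eLpNorm_eq_lintegral_rpow_enorm_toReal hd0 (ENNReal.natCast_ne_top d),
            ENNReal.toReal_natCast, one_div, ENNReal.rpow_inv_le_iff hdr] at h1
          exact h1
        · have : ψ t = 0 := by
            rw [← (φ n).support_normed_eq (μ := volume)] at ht
            simpa using ht
          simp [this]
    _ = ε ^ (d:ℝ) := by
        rw [lintegral_mul_const _ hψc.measurable.ennreal_ofReal,
          ← ofReal_integral_eq_lintegral_ofReal hψi (Filter.Eventually.of_forall hψ0),
          (φ n).integral_normed, ENNReal.ofReal_one, one_mul]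
end

section
variable {d : ℕ}

lemma gradient_coord {v : Eu d → ℝ} {x : Eu d} (hv : DifferentiableAt ℝ v x) (i : Fin d) :
    (gradient v x) i = fderiv ℝ v x (EuclideanSpace.single i 1) := by
  have h1 := hv.hasGradientAt.hasFDerivAt.fderiv
  rw [h1, InnerProductSpace.toDual_apply_apply, EuclideanSpace.inner_single_right]
  simp

lemma c2On_of_contDiff {v : Eu d → ℝ} (hv : ContDiff ℝ 2 v) :
    C2On v (gradient v) (fderiv ℝ (gradient v)) := by
  have hg : ContDiff ℝ 1 (gradient v) := by
    have h1 : ContDiff ℝ 1 (fderiv ℝ v) := hv.fderiv_right (by norm_num)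
    exact ((InnerProductSpace.toDual ℝ (Eu d)).symm.toContinuousLinearEquiv.contDiff).comp h1
  have hd : Differentiable ℝ v := hv.differentiable (by norm_num)
  refine ⟨fun x => (hd x).hasGradientAt, fun x =>
    ((hg.differentiable (by norm_num)) x).hasFDerivAt, hg.continuous_fderiv (by norm_num), ?_⟩
  intro x y z
  have hs : IsSymmSndFDerivAt ℝ v x :=
    (hv.contDiffAt (x := x)).isSymmSndFDerivAt (by simp)
  have key : ∀ y z : Eu d, inner ℝ (fderiv ℝ (gradient v) x y) z =
      fderiv ℝ (fderiv ℝ v) x y z := by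
    intro y z
    have h2 : (fun w => fderiv ℝ v w z) = fun w => inner ℝ (gradient v w) z := by
      funext w
      rw [(hd w).hasGradientAt.hasFDerivAt.fderiv, InnerProductSpace.toDual_apply_apply]
    have hf : DifferentiableAt ℝ (fderiv ℝ v) x :=
      (hv.fderiv_right (m := 1) (by norm_num)).differentiable (by norm_num) x
    have h3 := (hf.hasFDerivAt.clm_apply (hasFDerivAt_const z x)).fderiv
    have h4 := (((hg.differentiable (by norm_num)) x).hasFDerivAt.inner ℝ
      (hasFDerivAt_const z x)).fderiv
    rw [h2, h4] at h3
    have := congrArg (fun A => A y) h3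
    simpa using this
  rw [key, real_inner_comm, key, hs.eq]

lemma opMat_fderiv_gradient {v : Eu d → ℝ} (hv : ContDiff ℝ 2 v) (x : Eu d) (i j : Fin d) :
    opMat (fderiv ℝ (gradient v) x) i j =
      fderiv ℝ (fun y => fderiv ℝ v y (EuclideanSpace.single i 1)) x
        (EuclideanSpace.single j 1) := by
  have hd : Differentiable ℝ v := hv.differentiable (by norm_num)
  have e : (fun y => fderiv ℝ v y (EuclideanSpace.single i 1)) = fun y => (gradient v y) i := by
    funext y; rw [gradient_coord (hd y)]
  rw [e]
  have h1 := (c2On_of_contDiff hv).hess x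
  have h3 : HasFDerivAt (fun y => (gradient v y) i)
      ((EuclideanSpace.proj i : Eu d →L[ℝ] ℝ).comp (fderiv ℝ (gradient v) x)) x :=
    (EuclideanSpace.proj i : Eu d →L[ℝ] ℝ).hasFDerivAt.comp x h1
  rw [h3.fderiv]
  simp [opMat]

lemma conv_contDiff (φ : ContDiffBump (0 : Eu d)) {W : Eu d → ℝ}
    (hW : LocallyIntegrable W volume) :
    ContDiff ℝ 2 (convolution (φ.normed volume) W (ContinuousLinearMap.lsmul ℝ ℝ) volume) :=
  φ.hasCompactSupport_normed.contDiff_convolution_left _ φ.contDiff_normed hW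

lemma conv_fderiv_apply (φ : ContDiffBump (0 : Eu d)) {W W' : Eu d → ℝ}
    (hW : LocallyIntegrable W volume) (hW' : LocallyIntegrable W' volume) {x v : Eu d}
    (h : ∀ t ∈ Metric.closedBall (0 : Eu d) φ.rOut, HasLineDerivAt ℝ W (W' (x - t)) (x - t) v) :
    fderiv ℝ (convolution (φ.normed volume) W (ContinuousLinearMap.lsmul ℝ ℝ) volume) x v =
      (convolution (φ.normed volume) W' (ContinuousLinearMap.lsmul ℝ ℝ) volume) x := by
  set ψ := φ.normed (volume : Measure (Eu d)) with hψ
  have hψc : Continuous ψ := φ.continuous_normed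
  have hψs : HasCompactSupport ψ := φ.hasCompactSupport_normed
  have hψd : ContDiff ℝ 1 ψ := φ.contDiff_normed
  have hψd' : Continuous (fderiv ℝ ψ) := hψd.continuous_fderiv (by norm_num)
  have h1 := hψs.hasFDerivAt_convolution_left (ContinuousLinearMap.lsmul ℝ ℝ) hψd hW x
  rw [h1.fderiv]
  have hex : Integrable (fun t => ((ContinuousLinearMap.lsmul ℝ ℝ).precompL (Eu d)
      (fderiv ℝ ψ t)) (W (x - t)) : Eu d → (Eu d →L[ℝ] ℝ)) volume :=
    (hψs.fderiv ℝ).convolutionExists_left _ hψd' hW x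
  rw [convolution_def, ContinuousLinearMap.integral_apply hex, convolution_def]
  have hi1 : Integrable (fun t => (fderiv ℝ ψ t v) * W (x - t)) volume := by
    have := hex.apply_continuousLinearMap v
    simpa [ContinuousLinearMap.precompL_apply] using this
  have hi2 : ∀ {V : Eu d → ℝ}, LocallyIntegrable V volume →
      Integrable (fun t => ψ t * V (x - t)) volume := fun hV =>
    hψs.convolutionExists_left (ContinuousLinearMap.lsmul ℝ ℝ) hψc hV x
  have key := integral_bilinear_hasLineDerivAt_right_eq_neg_left_of_integrable (μ := volume)
    (f := ψ) (f' := fun t => fderiv ℝ ψ t v) (g := fun t => W (x - t))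
    (g' := fun t => - W' (x - t)) (v := v) (B := ContinuousLinearMap.lsmul ℝ ℝ)
    (by simpa using hi1) (by simpa using (hi2 hW').neg) (by simpa using hi2 hW)
    (fun t _ => ((hψd.differentiable (by norm_num)) t).hasFDerivAt.hasLineDerivAt v)
    (by
      intro t ht
      rw [hψ, φ.tsupport_normed_eq] at ht
      have h2 := h t ht
      unfold HasLineDerivAt at h2 ⊢
      have h3 : HasDerivAt (fun s : ℝ => W (x - t + s • v)) (W' (x - t)) (-(0:ℝ)) := by
        simpa using h2
      have h4 := h3.scomp (0:ℝ) (hasDerivAt_neg (0:ℝ))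
      refine (h4.congr_deriv (by simp)).congr_of_eventuallyEq ?_
      refine Filter.Eventually.of_forall fun s => ?_
      simp only [Function.comp]
      congr 1
      module)
  simp only [ContinuousLinearMap.lsmul_apply, smul_eq_mul, mul_neg, integral_neg, neg_inj] at key
  simp only [ContinuousLinearMap.precompL_apply, ContinuousLinearMap.lsmul_apply, smul_eq_mul]
  exact key.symm

end

section
variable {d : ℕ}

lemma abs_le_frobNorm (m : Matrix (Fin d) (Fin d) ℝ) (i j : Fin d) : |m i j| ≤ frobNorm m := by
  unfold frobNorm
  apply Real.le_sqrt_of_sq_le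
  rw [sq_abs]
  have h1 : (m i j) ^ 2 ≤ ∑ j, (m i j) ^ 2 :=
    Finset.single_le_sum (f := fun j => (m i j) ^ 2) (fun _ _ => sq_nonneg _) (Finset.mem_univ j)
  refine h1.trans (Finset.single_le_sum (f := fun i => ∑ j, (m i j) ^ 2)
    (fun _ _ => Finset.sum_nonneg fun _ _ => sq_nonneg _) (Finset.mem_univ i))

lemma trunc_memLp (hd : 1 ≤ d) {G : Set (Eu d)} (hG : MeasurableSet G) {F w : Eu d → ℝ}
    (hF : IntegrableOn F G volume) (hw : Measurable w) (h : ∀ x, |w x| ^ (d:ℝ) ≤ F x) :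
    MemLp (G.indicator w) d volume := by
  have hm : Measurable (G.indicator w) := hw.indicator hG
  have hd0 : (0:ℝ) < d := by exact_mod_cast hd
  have h0 : (d : ℝ≥0∞) ≠ 0 := by
    simp; omega
  rw [← integrable_norm_rpow_iff hm.aestronglyMeasurable h0 (by simp)]
  simp only [ENNReal.toReal_natCast]
  refine (hF.integrable_indicator hG).mono ?_ (Filter.Eventually.of_forall fun x => ?_)
  · exact (hm.norm.pow_const _).aestronglyMeasurable
  · by_cases hx : x ∈ G
    · simp only [indicator_of_mem hx, Real.norm_eq_abs]
      rw [abs_of_nonneg (by positivity)]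
      exact (h x).trans (le_abs_self _)
    · simp only [indicator_of_notMem hx]
      simp [Real.zero_rpow hd0.ne']

lemma lineDeriv_trunc {R' : ℝ} {w w' : Eu d → ℝ} {y v : Eu d}
    (hy : y ∈ Metric.ball (0 : Eu d) R')
    (h : HasDerivAt (fun s : ℝ => w (y + s • v)) (w' y) 0) :
    HasLineDerivAt ℝ ((Metric.closedBall (0 : Eu d) R').indicator w)
      ((Metric.closedBall (0 : Eu d) R').indicator w' y) y v := by
  rw [indicator_of_mem (Metric.ball_subset_closedBall hy)]
  unfold HasLineDerivAt
  refine h.congr_of_eventuallyEq ?_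
  have hc : Continuous fun s : ℝ => y + s • v := by fun_prop
  have : (fun s : ℝ => y + s • v) ⁻¹' (Metric.ball (0 : Eu d) R') ∈ nhds (0:ℝ) := by
    apply hc.continuousAt.preimage_mem_nhds
    apply Metric.isOpen_ball.mem_nhds
    simpa using hy
  filter_upwards [this] with s hs
  rw [indicator_of_mem (Metric.ball_subset_closedBall hs)]

set_option maxHeartbeats 1000000 in
lemma approx_exists (hd : 1 ≤ d) {u : Eu d → ℝ} {du : Eu d → Eu d}
    {d2u : Eu d → Matrix (Fin d) (Fin d) ℝ}
    (hum : Measurable u) (hdum : ∀ i, Measurable fun x => du x i)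
    (hd2m : ∀ i j, Measurable fun x => d2u x i j)
    (huc : ContinuousOn u (Metric.closedBall (0 : Eu d) 1))
    (h1 : ∀ x ∈ Metric.ball (0 : Eu d) 1, ∀ i,
          HasDerivAt (fun s : ℝ => u (x + s • EuclideanSpace.single i (1 : ℝ))) (du x i) 0)
    (h2 : ∀ x ∈ Metric.ball (0 : Eu d) 1, ∀ i j,
          HasDerivAt (fun s : ℝ => du (x + s • EuclideanSpace.single j (1 : ℝ)) i) (d2u x i j) 0)
    (hInteg : ∀ G : Set (Eu d), IsCompact G → G ⊆ Metric.ball (0 : Eu d) 1 →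
          IntegrableOn (fun x => |u x| ^ (d : ℝ) + ‖du x‖ ^ (d : ℝ) + frobNorm (d2u x) ^ (d : ℝ))
            G volume)
    {R : ℝ} (hR0 : 0 < R) (hR1 : R < 1) :
    ∃ (v : ℕ → Eu d → ℝ) (g : ℕ → Eu d → Eu d) (H : ℕ → Eu d → Eu d →L[ℝ] Eu d),
      (∀ n, C2On (v n) (g n) (H n)) ∧
      (∀ ε > 0, ∀ᶠ n in Filter.atTop, ∀ x ∈ Metric.closedBall (0 : Eu d) R, |v n x - u x| ≤ ε) ∧
      Filter.Tendsto (fun n => eLpNorm (fun x => v n x - u x) d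
        (volume.restrict (Metric.ball 0 R))) Filter.atTop (nhds 0) ∧
      (∀ i, Filter.Tendsto (fun n => eLpNorm (fun x => g n x i - du x i) d
        (volume.restrict (Metric.ball 0 R))) Filter.atTop (nhds 0)) ∧
      (∀ i j, Filter.Tendsto (fun n => eLpNorm (fun x => opMat (H n x) i j - d2u x i j) d
        (volume.restrict (Metric.ball 0 R))) Filter.atTop (nhds 0)) ∧
      (∀ᵐ x ∂(volume.restrict (Metric.ball 0 R)), ∀ i,
        Filter.Tendsto (fun n => g n x i) Filter.atTop (nhds (du x i))) := by
  have hd1 : (0:ℝ) ≤ d := by positivity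
  haveI : Fact ((1:ℝ≥0∞) ≤ d) := ⟨by exact_mod_cast hd⟩
  set R' : ℝ := (1 + R) / 2 with hR'
  have hRR' : R < R' := by rw [hR']; linarith
  have hR'1 : R' < 1 := by rw [hR']; linarith
  set G : Set (Eu d) := Metric.closedBall 0 R' with hGdef
  have hGm : MeasurableSet G := Metric.isClosed_closedBall.measurableSet
  have hG1 : G ⊆ Metric.ball 0 1 := Metric.closedBall_subset_ball hR'1
  have hRG : Metric.ball (0 : Eu d) R ⊆ G :=
    (Metric.ball_subset_ball hRR'.le).trans Metric.ball_subset_closedBall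
  have hF := hInteg G (isCompact_closedBall _ _) hG1
  have hfn : ∀ m : Matrix (Fin d) (Fin d) ℝ, 0 ≤ frobNorm m := fun m => Real.sqrt_nonneg _
  have mU : MemLp (G.indicator u) d volume := by
    refine trunc_memLp hd hGm hF hum fun x => ?_
    have := Real.rpow_nonneg (norm_nonneg (du x)) d
    have := Real.rpow_nonneg (hfn (d2u x)) d
    linarith
  have mD : ∀ i, MemLp (G.indicator fun x => du x i) d volume := by
    intro i
    refine trunc_memLp hd hGm hF (hdum i) fun x => ?_
    have := Real.rpow_nonneg (abs_nonneg (u x)) d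
    have := Real.rpow_nonneg (hfn (d2u x)) d
    have h3 : |du x i| ^ (d:ℝ) ≤ ‖du x‖ ^ (d:ℝ) :=
      Real.rpow_le_rpow (abs_nonneg _) (by simpa using PiLp.norm_apply_le (du x) i) hd1
    linarith
  have mH : ∀ i j, MemLp (G.indicator fun x => d2u x i j) d volume := by
    intro i j
    refine trunc_memLp hd hGm hF (hd2m i j) fun x => ?_
    have := Real.rpow_nonneg (abs_nonneg (u x)) d
    have := Real.rpow_nonneg (norm_nonneg (du x)) d
    have h3 : |d2u x i j| ^ (d:ℝ) ≤ frobNorm (d2u x) ^ (d:ℝ) :=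
      Real.rpow_le_rpow (abs_nonneg _) (abs_le_frobNorm _ i j) hd1
    linarith
  have hloc : ∀ {W : Eu d → ℝ}, MemLp W d volume → LocallyIntegrable W volume :=
    fun hW => hW.locallyIntegrable (by exact_mod_cast hd)
  -- bumps
  have hr : ∀ n : ℕ, 0 < (R' - R) / (n + 2) := fun n => by
    have : 0 < R' - R := by linarith
    positivity
  let φ : ℕ → ContDiffBump (0 : Eu d) := fun n =>
    ⟨(R' - R) / (n + 2) / 2, (R' - R) / (n + 2), half_pos (hr n), half_lt_self (hr n)⟩
  have hφr : ∀ n, (φ n).rOut < R' - R := by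
    intro n
    change (R' - R) / (n + 2) < R' - R
    rw [div_lt_iff₀ (by positivity)]
    have h0 : 0 < R' - R := by linarith
    have hn : (0:ℝ) ≤ n := by positivity
    nlinarith
  have hφ0 : Filter.Tendsto (fun n => (φ n).rOut) Filter.atTop (nhds 0) := by
    change Filter.Tendsto (fun n : ℕ => (R' - R) / ((n:ℝ) + 2)) Filter.atTop (nhds 0)
    exact Filter.Tendsto.const_div_atTop
      (Filter.tendsto_atTop_add_const_right _ _ tendsto_natCast_atTop_atTop) _
  have hφ2 : ∀ n, (φ n).rOut ≤ 2 * (φ n).rIn := by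
    intro n
    change (R' - R) / (n + 2) ≤ 2 * ((R' - R) / (n + 2) / 2)
    linarith
  let C : ℕ → (Eu d → ℝ) → Eu d → ℝ := fun n W =>
    convolution ((φ n).normed volume) W (ContinuousLinearMap.lsmul ℝ ℝ) volume
  have hmem : ∀ n, ∀ x ∈ Metric.ball (0 : Eu d) R, ∀ t ∈ Metric.closedBall (0 : Eu d) (φ n).rOut,
      x - t ∈ Metric.ball (0 : Eu d) R' := by
    intro n x hx t ht
    rw [mem_ball_zero_iff] at hx ⊢
    rw [mem_closedBall_zero_iff] at ht
    have := norm_sub_le x t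
    have := hφr n
    linarith
  have hcd : ∀ n, ContDiff ℝ 2 (C n (G.indicator u)) := fun n => conv_contDiff (φ n) (hloc mU)
  have hgr : ∀ n, ∀ x ∈ Metric.ball (0 : Eu d) R, ∀ i,
      fderiv ℝ (C n (G.indicator u)) x (EuclideanSpace.single i 1) =
        C n (G.indicator fun x => du x i) x := by
    intro n x hx i
    refine conv_fderiv_apply (φ n) (hloc mU) (hloc (mD i)) fun t ht => ?_
    have h3 := hmem n x hx t ht
    exact lineDeriv_trunc (w := u) (w' := fun x => du x i) h3
      (h1 _ (hG1 (Metric.ball_subset_closedBall h3)) i)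
  have hgr' : ∀ n, ∀ x ∈ Metric.ball (0 : Eu d) R, ∀ i,
      (gradient (C n (G.indicator u)) x) i = C n (G.indicator fun x => du x i) x := by
    intro n x hx i
    rw [gradient_coord ((hcd n).differentiable (by norm_num) x), hgr n x hx i]
  have hhs : ∀ n, ∀ x ∈ Metric.ball (0 : Eu d) R, ∀ i j,
      opMat (fderiv ℝ (gradient (C n (G.indicator u))) x) i j =
        C n (G.indicator fun x => d2u x i j) x := by
    intro n x hx i j
    rw [opMat_fderiv_gradient (hcd n)]
    have he : (fun y => fderiv ℝ (C n (G.indicator u)) y (EuclideanSpace.single i 1)) =ᶠ[nhds x]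
        C n (G.indicator fun x => du x i) := by
      filter_upwards [Metric.isOpen_ball.mem_nhds hx] with y hy
      exact hgr n y hy i
    rw [he.fderiv_eq]
    refine conv_fderiv_apply (φ n) (hloc (mD i)) (hloc (mH i j)) fun t ht => ?_
    have h3 := hmem n x hx t ht
    exact lineDeriv_trunc (w := fun x => du x i) (w' := fun x => d2u x i j) h3
      (h2 _ (hG1 (Metric.ball_subset_closedBall h3)) i j)
  have hLp : ∀ {w : Eu d → ℝ} {V : ℕ → Eu d → ℝ}, Measurable w →
      MemLp (G.indicator w) d volume →
      (∀ n, ∀ x ∈ Metric.ball (0 : Eu d) R, V n x = C n (G.indicator w) x) →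
      Filter.Tendsto (fun n => eLpNorm (fun x => V n x - w x) d
        (volume.restrict (Metric.ball 0 R))) Filter.atTop (nhds 0) := by
    intro w V hw hm hV
    have h3 := tendsto_conv_Lp hd hφ0 (hw.indicator hGm) hm
    refine tendsto_of_tendsto_of_tendsto_of_le_of_le tendsto_const_nhds h3
      (fun _ => zero_le) fun n => ?_
    refine le_trans (le_of_eq ?_) (eLpNorm_mono_measure _
      (Measure.restrict_le_self (s := Metric.ball (0 : Eu d) R)))
    apply eLpNorm_congr_ae
    filter_upwards [ae_restrict_mem Metric.isOpen_ball.measurableSet] with x hx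
    rw [hV n x hx, indicator_of_mem (hRG hx)]
  refine ⟨fun n => C n (G.indicator u), fun n => gradient (C n (G.indicator u)),
    fun n => fderiv ℝ (gradient (C n (G.indicator u))), fun n => c2On_of_contDiff (hcd n), ?_,
    hLp hum mU fun _ _ _ => rfl, fun i => ?_, fun i j => ?_, ?_⟩
  · intro ε hε
    have huu := (isCompact_closedBall (0 : Eu d) 1).uniformContinuousOn_of_continuous huc
    rw [Metric.uniformContinuousOn_iff] at huu
    obtain ⟨η, hη, hu⟩ := huu ε hε
    filter_upwards [hφ0.eventually_lt_const hη] with n hn x hx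
    have hxG : x ∈ G := Metric.closedBall_subset_closedBall hRR'.le hx
    have h3 := (φ n).dist_normed_convolution_le (μ := volume) (g := G.indicator u) (x₀ := x)
      (ε := ε) (hum.indicator hGm).aestronglyMeasurable (by
        intro y hy
        have hyG : y ∈ G := by
          rw [hGdef, mem_closedBall_zero_iff]
          rw [mem_closedBall_zero_iff] at hx
          rw [mem_ball_iff_norm] at hy
          have h5 := norm_add_le x (y - x)
          rw [add_sub_cancel] at h5
          have := hφr n
          linarith
        rw [indicator_of_mem hxG, indicator_of_mem hyG]
        exact (hu y (Metric.ball_subset_closedBall (hG1 hyG)) x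
          (Metric.ball_subset_closedBall (hG1 hxG)) ((Metric.mem_ball.1 hy).trans hn)).le)
    rw [indicator_of_mem hxG, Real.dist_eq] at h3
    exact h3
  · exact hLp (V := fun n x => gradient (C n (G.indicator u)) x i) (hdum i) (mD i)
      fun n x hx => hgr' n x hx i
  · exact hLp (V := fun n x => opMat (fderiv ℝ (gradient (C n (G.indicator u))) x) i j)
      (hd2m i j) (mH i j) fun n x hx => hhs n x hx i j
  · rw [ae_all_iff]
    intro i
    have h3 := ContDiffBump.ae_convolution_tendsto_right_of_locallyIntegrable (μ := volume)
      (K := 2) hφ0 (Filter.Eventually.of_forall hφ2) (hloc (mD i))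
    filter_upwards [ae_restrict_mem Metric.isOpen_ball.measurableSet, ae_restrict_of_ae h3]
      with x hx h4
    rw [indicator_of_mem (hRG hx)] at h4
    exact h4.congr fun n => (hgr' n x hx i).symm

end

section
variable {d : ℕ}
lemma entry_bound {δ : ℝ} (hδ : 0 < δ) {a : Matrix (Fin d) (Fin d) ℝ} (hs : a.IsSymm)
    (ha : ∀ ξ : Eu d, δ * ‖ξ‖ ^ 2 ≤ ∑ i, ∑ j, a i j * ξ i * ξ j ∧
          ∑ i, ∑ j, a i j * ξ i * ξ j ≤ δ⁻¹ * ‖ξ‖ ^ 2) (i j : Fin d) : |a i j| ≤ δ⁻¹ := by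
  have hq : ∀ s : ℝ, ∑ k, ∑ l, a k l * (EuclideanSpace.single i (1:ℝ) +
      s • EuclideanSpace.single j (1:ℝ) : Eu d) k * (EuclideanSpace.single i (1:ℝ) +
      s • EuclideanSpace.single j (1:ℝ) : Eu d) l = a i i + 2 * s * a i j + s ^ 2 * a j j := by
    intro s
    have := hs.apply i j
    simp [mul_add, add_mul, Finset.sum_add_distrib, Pi.single_apply]
    rw [this]; ring
  have h0 := hq 0
  have h1 := hq 1
  have h2 := hq (-1)
  have b0 := ha (EuclideanSpace.single i (1:ℝ) + (0:ℝ) • EuclideanSpace.single j (1:ℝ))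
  have b1 := ha (EuclideanSpace.single i (1:ℝ) + (1:ℝ) • EuclideanSpace.single j (1:ℝ))
  have b2 := ha (EuclideanSpace.single i (1:ℝ) + (-1:ℝ) • EuclideanSpace.single j (1:ℝ))
  rw [h0] at b0
  rw [h1] at b1
  rw [h2] at b2
  have hi : (0:ℝ) < δ⁻¹ := by positivity
  by_cases hij : i = j
  · subst hij
    simp at b0
    rw [abs_le]; constructor <;> linarith
  · have n1 : ‖(EuclideanSpace.single i (1:ℝ) + (1:ℝ) • EuclideanSpace.single j (1:ℝ) : Eu d)‖ ^ 2 = 2 := by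
      rw [norm_add_sq_real]
      simp [EuclideanSpace.inner_single_left, hij, Ne.symm hij]; norm_num
    have n2 : ‖(EuclideanSpace.single i (1:ℝ) + (-1:ℝ) • EuclideanSpace.single j (1:ℝ) : Eu d)‖ ^ 2 = 2 := by
      rw [norm_add_sq_real]
      simp [EuclideanSpace.inner_single_left, hij, Ne.symm hij]; norm_num
    rw [n1] at b1
    rw [n2] at b2
    rw [abs_le]; constructor <;> linarith

lemma eLpNorm_mul_bdd {μ : Measure (Eu d)} {M : ℝ} {α f : Eu d → ℝ} (hα : ∀ x, |α x| ≤ M)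
    (p : ℝ≥0∞) : eLpNorm (fun x => α x * f x) p μ ≤ ENNReal.ofReal M * eLpNorm f p μ := by
  refine eLpNorm_le_mul_eLpNorm_of_ae_le_mul (Filter.Eventually.of_forall fun x => ?_) p
  rw [norm_mul]
  exact mul_le_mul_of_nonneg_right (hα x) (norm_nonneg _)

lemma meas_sum_fun {F : Fin d → Eu d → ℝ} (hF : ∀ i, Measurable (F i)) :
    Measurable (∑ i, F i) := by
  have h1 := Finset.measurable_sum Finset.univ fun i _ => hF i
  have h2 : (∑ i, F i) = fun x => ∑ i, F i x := by
    funext x; simp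
  rw [h2]
  exact h1

lemma op_Lp0 {μ : Measure (Eu d)} {M : ℝ} {p : ℝ≥0∞} (hp : 1 ≤ p)
    {a h : Eu d → Fin d → Fin d → ℝ} {b k : Eu d → Fin d → ℝ} {c w : Eu d → ℝ}
    (ham : ∀ i j, Measurable fun x => a x i j) (hbm : ∀ i, Measurable fun x => b x i)
    (hcm : Measurable c)
    (hhm : ∀ i j, Measurable fun x => h x i j) (hkm : ∀ i, Measurable fun x => k x i)
    (hwm : Measurable w)
    (ha : ∀ i j x, |a x i j| ≤ M) (hb : ∀ i x, |b x i| ≤ M) (hc : ∀ x, |c x| ≤ M) :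
    eLpNorm (fun x => (∑ i, ∑ j, a x i j * h x i j) + (∑ i, b x i * k x i) - c x * w x) p μ ≤
      ENNReal.ofReal M * (∑ i, ∑ j, eLpNorm (fun x => h x i j) p μ +
        ∑ i, eLpNorm (fun x => k x i) p μ + eLpNorm w p μ) := by
  have e1 : (fun x => (∑ i, ∑ j, a x i j * h x i j) + (∑ i, b x i * k x i) - c x * w x) =
      ((∑ i, ∑ j, fun x => a x i j * h x i j) + ∑ i, fun x => b x i * k x i) -
        fun x => c x * w x := by
    funext x
    simp
  have m1 : ∀ i j, Measurable fun x => a x i j * h x i j := fun i j => (ham i j).mul (hhm i j)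
  have m2 : ∀ i, Measurable fun x => b x i * k x i := fun i => (hbm i).mul (hkm i)
  have m1' : ∀ i, Measurable (∑ j, fun x => a x i j * h x i j) := fun i =>
    meas_sum_fun fun j => m1 i j
  have m1'' : Measurable (∑ i, ∑ j, fun x => a x i j * h x i j) :=
    meas_sum_fun fun i => m1' i
  have m2' : Measurable (∑ i, fun x => b x i * k x i) :=
    meas_sum_fun fun i => m2 i
  rw [e1]
  refine (eLpNorm_sub_le (m1''.add m2').aestronglyMeasurable
    (hcm.mul hwm).aestronglyMeasurable hp).trans ?_
  rw [mul_add, mul_add]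
  refine add_le_add ((eLpNorm_add_le m1''.aestronglyMeasurable m2'.aestronglyMeasurable hp).trans
    (add_le_add ?_ ?_)) (eLpNorm_mul_bdd hc p)
  · refine (eLpNorm_sum_le (fun i _ => (m1' i).aestronglyMeasurable) hp).trans ?_
    rw [Finset.mul_sum]
    refine Finset.sum_le_sum fun i _ => ?_
    refine (eLpNorm_sum_le (fun j _ => (m1 i j).aestronglyMeasurable) hp).trans ?_
    rw [Finset.mul_sum]
    exact Finset.sum_le_sum fun j _ => eLpNorm_mul_bdd (ha i j) p
  · refine (eLpNorm_sum_le (fun i _ => (m2 i).aestronglyMeasurable) hp).trans ?_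
    rw [Finset.mul_sum]
    exact Finset.sum_le_sum fun i _ => eLpNorm_mul_bdd (hb i) p

lemma eLpNorm_pow_eq (hd : 1 ≤ d) (μ : Measure (Eu d)) (f : Eu d → ℝ) :
    ∫⁻ x, ENNReal.ofReal |f x| ^ (d:ℝ) ∂μ = eLpNorm f d μ ^ (d:ℝ) := by
  have h0 : (d : ℝ≥0∞) ≠ 0 := by
    simp; omega
  have hd0 : (d:ℝ) ≠ 0 := by
    simp; omega
  rw [eLpNorm_eq_lintegral_rpow_enorm_toReal h0 (by simp), ENNReal.toReal_natCast,
    ← ENNReal.rpow_mul, one_div, inv_mul_cancel₀ hd0, ENNReal.rpow_one]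
  simp only [Real.enorm_eq_ofReal_abs]

set_option maxHeartbeats 2000000 in
lemma core_R (hd : 1 ≤ d) {δ K γ N : ℝ} (hδ : 0 < δ) (hK : 0 ≤ K) (hγ : 0 < γ)
    {a : Eu d → Matrix (Fin d) (Fin d) ℝ} {b : Eu d → Eu d} {c : Eu d → ℝ}
    (hsym : ∀ x, (a x).IsSymm)
    (hell : ∀ x (ξ : Eu d), δ * ‖ξ‖ ^ 2 ≤ ∑ i, ∑ j, a x i j * ξ i * ξ j ∧
          ∑ i, ∑ j, a x i j * ξ i * ξ j ≤ δ⁻¹ * ‖ξ‖ ^ 2)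
    (hbc : ∀ x, ‖b x‖ + c x ≤ K) (hc0 : ∀ x, 0 ≤ c x)
    (hsm : ∀ (v : Eu d → ℝ) (g : Eu d → Eu d) (H : Eu d → Eu d →L[ℝ] Eu d)
      (_ : C2On v g H) (R : ℝ) (_ : 1 / 2 ≤ R) (_ : R ≤ 1)
      (_ : ∫⁻ x in Metric.ball 0 R, ENNReal.ofReal
        |∑ i, ∑ j, a x i j * opMat (H x) i j + inner ℝ (b x) (g x) - c x * v x| ^ d ≤ 1)
      (_ : ∀ x ∈ Metric.sphere 0 R, |v x| ≤ 1),
      ∫⁻ x in Metric.ball 0 R, ENNReal.ofReal ‖g x‖ ^ γ ≤ ENNReal.ofReal N)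
    {u : Eu d → ℝ} {du : Eu d → Eu d} {d2u : Eu d → Matrix (Fin d) (Fin d) ℝ}
    (ham : ∀ i j, Measurable fun x => a x i j) (hbm : ∀ i, Measurable fun x => b x i)
    (hcm : Measurable c)
    (hum : Measurable u) (hdum : ∀ i, Measurable fun x => du x i)
    (hd2m : ∀ i j, Measurable fun x => d2u x i j)
    (huc : ContinuousOn u (Metric.closedBall (0 : Eu d) 1))
    (h1 : ∀ x ∈ Metric.ball (0 : Eu d) 1, ∀ i,
          HasDerivAt (fun s : ℝ => u (x + s • EuclideanSpace.single i (1 : ℝ))) (du x i) 0)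
    (h2 : ∀ x ∈ Metric.ball (0 : Eu d) 1, ∀ i j,
          HasDerivAt (fun s : ℝ => du (x + s • EuclideanSpace.single j (1 : ℝ)) i) (d2u x i j) 0)
    (hInteg : ∀ G : Set (Eu d), IsCompact G → G ⊆ Metric.ball (0 : Eu d) 1 →
          IntegrableOn (fun x => |u x| ^ (d : ℝ) + ‖du x‖ ^ (d : ℝ) + frobNorm (d2u x) ^ (d : ℝ))
            G volume)
    (hLu : ∫⁻ x in Metric.ball (0 : Eu d) 1, ENNReal.ofReal
      |(∑ i, ∑ j, a x i j * d2u x i j) + (∑ i, b x i * du x i) - c x * u x| ^ (d:ℝ) < 1)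
    {R s : ℝ} (hR2 : 1 / 2 ≤ R) (hR1 : R < 1) (hs : s < 1)
    (hus : ∀ x ∈ Metric.sphere (0 : Eu d) R, |u x| ≤ s) :
    ∫⁻ x in Metric.ball (0 : Eu d) R, ENNReal.ofReal ‖du x‖ ^ γ ≤ ENNReal.ofReal N := by
  obtain ⟨v, g, H, hC2, hunif, hv, hg, hH, hae⟩ :=
    approx_exists hd hum hdum hd2m huc h1 h2 hInteg (R := R) (by linarith) hR1
  have hd0 : (0:ℝ) < d := by exact_mod_cast hd
  have hp : (1:ℝ≥0∞) ≤ d := by exact_mod_cast hd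
  set μ := (volume : Measure (Eu d)).restrict (Metric.ball 0 R) with hμ
  set M : ℝ := δ⁻¹ + K with hM
  have hδi : 0 < δ⁻¹ := by positivity
  have hb : ∀ i x, |b x i| ≤ M := by
    intro i x
    have h3 : |b x i| ≤ ‖b x‖ := by simpa using PiLp.norm_apply_le (b x) i
    have := hbc x
    have := hc0 x
    linarith
  have hc : ∀ x, |c x| ≤ M := by
    intro x
    rw [abs_of_nonneg (hc0 x)]
    have := hbc x
    have := norm_nonneg (b x)
    linarith
  have ha : ∀ i j x, |a x i j| ≤ M := fun i j x =>
    (entry_bound hδ (hsym x) (hell x) i j).trans (by linarith)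
  set f : Eu d → ℝ := fun x =>
    (∑ i, ∑ j, a x i j * d2u x i j) + (∑ i, b x i * du x i) - c x * u x with hf
  have hfm : Measurable f := by
    refine ((Finset.measurable_sum _ fun i _ => Finset.measurable_sum _ fun j _ =>
      (ham i j).mul (hd2m i j)).add (Finset.measurable_sum _ fun i _ =>
      (hbm i).mul (hdum i))).sub (hcm.mul hum)
  have hfL : eLpNorm f d μ < 1 := by
    have h3 : eLpNorm f d μ ^ (d:ℝ) < 1 := by
      rw [← eLpNorm_pow_eq hd]
      exact lt_of_le_of_lt (lintegral_mono_set (Metric.ball_subset_ball hR1.le)) hLu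
    by_contra h4
    push Not at h4
    exact absurd h3 (not_lt.2 (ENNReal.one_le_rpow h4 hd0))
  have gm : ∀ n i, Measurable fun x => g n x i := fun n i => by
    have := (hC2 n).continuous_grad
    exact (show Continuous fun x => g n x i by fun_prop).measurable
  have vm : ∀ n, Measurable (v n) := fun n => (hC2 n).continuous.measurable
  have Hm : ∀ n i j, Measurable fun x => opMat (H n x) i j := fun n i j => by
    have := (hC2 n).cont
    exact (show Continuous fun x => (H n x (EuclideanSpace.single j 1)) i by fun_prop).measurable
  set E : ℕ → ℝ≥0∞ := fun n => ENNReal.ofReal M *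
    (∑ i, ∑ j, eLpNorm (fun x => opMat (H n x) i j - d2u x i j) d μ +
        ∑ i, eLpNorm (fun x => g n x i - du x i) d μ + eLpNorm (fun x => v n x - u x) d μ) with hE
  have hE0 : Filter.Tendsto E Filter.atTop (nhds 0) := by
    have h3 := ((tendsto_finsetSum Finset.univ fun i _ =>
      tendsto_finsetSum Finset.univ fun j _ => hH i j).add
      (tendsto_finsetSum Finset.univ fun i _ => hg i)).add hv
    have h4 := ENNReal.Tendsto.const_mul (a := ENNReal.ofReal M) h3 (Or.inr ENNReal.ofReal_ne_top)
    simpa using h4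
  have hev1 : ∀ᶠ n in Filter.atTop, eLpNorm f d μ + E n ≤ 1 := by
    have h3 : Filter.Tendsto (fun n => eLpNorm f d μ + E n) Filter.atTop
        (nhds (eLpNorm f d μ + 0)) := tendsto_const_nhds.add hE0
    rw [add_zero] at h3
    exact (h3.eventually_lt_const hfL).mono fun _ h => h.le
  have hev2 := hunif (1 - s) (by linarith)
  have hbound : ∀ᶠ n in Filter.atTop,
      ∫⁻ x, ENNReal.ofReal ‖g n x‖ ^ γ ∂μ ≤ ENNReal.ofReal N := by
    filter_upwards [hev1, hev2] with n hn1 hn2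
    refine hsm (v n) (g n) (H n) (hC2 n) R hR2 hR1.le ?_ ?_
    · have e1 : (fun x => ∑ i, ∑ j, a x i j * opMat (H n x) i j + inner ℝ (b x) (g n x) -
          c x * v n x) = f + fun x => (∑ i, ∑ j, a x i j * (opMat (H n x) i j - d2u x i j)) +
            (∑ i, b x i * (g n x i - du x i)) - c x * (v n x - u x) := by
        funext x
        simp only [Pi.add_apply, hf, mul_sub, Finset.sum_sub_distrib]
        have : inner ℝ (b x) (g n x) = ∑ i, b x i * g n x i := by
          simp [PiLp.inner_apply, mul_comm]
        rw [this]
        ring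
      have h5 := op_Lp0 (μ := μ) hp ham hbm hcm
        (h := fun x i j => opMat (H n x) i j - d2u x i j) (k := fun x i => g n x i - du x i)
        (w := fun x => v n x - u x)
        (fun i j => (Hm n i j).sub (hd2m i j)) (fun i => (gm n i).sub (hdum i))
        ((vm n).sub hum) ha hb hc
      have hDm : Measurable fun x => (∑ i, ∑ j, a x i j * (opMat (H n x) i j - d2u x i j)) +
            (∑ i, b x i * (g n x i - du x i)) - c x * (v n x - u x) := by
        refine ((Finset.measurable_sum _ fun i _ => Finset.measurable_sum _ fun j _ =>
          (ham i j).mul ((Hm n i j).sub (hd2m i j))).add (Finset.measurable_sum _ fun i _ =>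
          (hbm i).mul ((gm n i).sub (hdum i)))).sub (hcm.mul ((vm n).sub hum))
      have h6 := (eLpNorm_add_le (μ := μ) hfm.aestronglyMeasurable hDm.aestronglyMeasurable
        hp).trans ((add_le_add le_rfl h5).trans hn1)
      rw [← e1] at h6
      have h7 := eLpNorm_pow_eq hd μ (fun x => ∑ i, ∑ j, a x i j * opMat (H n x) i j +
        inner ℝ (b x) (g n x) - c x * v n x)
      simp only [ENNReal.rpow_natCast] at h7
      rw [h7]
      exact pow_le_one' h6 d
    · intro x hx
      have h3 := hn2 x (Metric.sphere_subset_closedBall hx)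
      have h4 := hus x hx
      have h5 := abs_add_le (v n x - u x) (u x)
      rw [sub_add_cancel] at h5
      linarith
  have hlim : ∀ᵐ x ∂μ, ENNReal.ofReal ‖du x‖ ^ γ ≤
      Filter.liminf (fun n => ENNReal.ofReal ‖g n x‖ ^ γ) Filter.atTop := by
    filter_upwards [hae] with x hx
    have h3 : Filter.Tendsto (fun n => ‖g n x‖) Filter.atTop (nhds ‖du x‖) := by
      simp only [EuclideanSpace.norm_eq]
      exact (Real.continuous_sqrt.tendsto _).comp
        (tendsto_finsetSum Finset.univ fun i _ => ((hx i).norm.pow 2))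
    have h4 : Filter.Tendsto (fun n => ENNReal.ofReal ‖g n x‖ ^ γ) Filter.atTop
        (nhds (ENNReal.ofReal ‖du x‖ ^ γ)) :=
      (ENNReal.continuous_rpow_const.tendsto _).comp (ENNReal.tendsto_ofReal h3)
    exact h4.liminf_eq.ge
  refine (lintegral_mono_ae hlim).trans ?_
  refine (lintegral_liminf_le fun n => ?_).trans ?_
  · exact ((hC2 n).continuous_grad.norm.measurable.ennreal_ofReal).pow_const γ
  · exact Filter.liminf_le_of_frequently_le' hbound.frequently

end

section
variable {d : ℕ}

/-- Coefficients of an operator in the class with constants `δ`, `K`. -/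
structure Coef (δ K : ℝ) (a : Eu d → Matrix (Fin d) (Fin d) ℝ) (b : Eu d → Eu d)
    (c : Eu d → ℝ) : Prop where
  am : ∀ i j, Measurable fun x => a x i j
  bm : ∀ i, Measurable fun x => b x i
  cm : Measurable c
  sym : ∀ x, (a x).IsSymm
  ell : ∀ x (ξ : Eu d), δ * ‖ξ‖ ^ 2 ≤ ∑ i, ∑ j, a x i j * ξ i * ξ j ∧
          ∑ i, ∑ j, a x i j * ξ i * ξ j ≤ δ⁻¹ * ‖ξ‖ ^ 2
  bc : ∀ x, ‖b x‖ + c x ≤ K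
  c0 : ∀ x, 0 ≤ c x

/-- Admissible functions. -/
structure Adm (u : Eu d → ℝ) (du : Eu d → Eu d) (d2u : Eu d → Matrix (Fin d) (Fin d) ℝ) :
    Prop where
  um : Measurable u
  dum : ∀ i, Measurable fun x => du x i
  d2m : ∀ i j, Measurable fun x => d2u x i j
  uc : ContinuousOn u (Metric.closedBall (0 : Eu d) 1)
  h1 : ∀ x ∈ Metric.ball (0 : Eu d) 1, ∀ i,
          HasDerivAt (fun s : ℝ => u (x + s • EuclideanSpace.single i (1 : ℝ))) (du x i) 0
  h2 : ∀ x ∈ Metric.ball (0 : Eu d) 1, ∀ i j,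
          HasDerivAt (fun s : ℝ => du (x + s • EuclideanSpace.single j (1 : ℝ)) i) (d2u x i j) 0
  int : ∀ G : Set (Eu d), IsCompact G → G ⊆ Metric.ball (0 : Eu d) 1 →
          IntegrableOn (fun x => |u x| ^ (d : ℝ) + ‖du x‖ ^ (d : ℝ) + frobNorm (d2u x) ^ (d : ℝ))
            G volume

lemma frobNorm_smul (t : ℝ) (m : Matrix (Fin d) (Fin d) ℝ) :
    frobNorm (t • m) = |t| * frobNorm m := by
  unfold frobNorm
  have : ∑ i, ∑ j, ((t • m) i j) ^ 2 = t ^ 2 * ∑ i, ∑ j, (m i j) ^ 2 := by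
    simp only [Matrix.smul_apply, smul_eq_mul, mul_pow, Finset.mul_sum]
  rw [this, Real.sqrt_mul (sq_nonneg t), Real.sqrt_sq_eq_abs]

lemma Adm.scale {u : Eu d → ℝ} {du : Eu d → Eu d} {d2u : Eu d → Matrix (Fin d) (Fin d) ℝ}
    (h : Adm u du d2u) (t : ℝ) :
    Adm (fun x => t * u x) (fun x => t • du x) (fun x => t • d2u x) where
  um := h.um.const_mul t
  dum i := by simpa using (h.dum i).const_mul t
  d2m i j := by simpa using (h.d2m i j).const_mul t
  uc := continuousOn_const.mul h.uc
  h1 x hx i := by simpa using (h.h1 x hx i).const_mul t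
  h2 x hx i j := by simpa using (h.h2 x hx i j).const_mul t
  int G hG hG1 := by
    have h3 := (h.int G hG hG1).const_mul (|t| ^ (d:ℝ))
    refine h3.congr (Filter.Eventually.of_forall fun x => ?_)
    have hf : 0 ≤ frobNorm (d2u x) := Real.sqrt_nonneg _
    simp only [frobNorm_smul, norm_smul, abs_mul, Real.norm_eq_abs]
    rw [Real.mul_rpow (abs_nonneg _) (abs_nonneg _), Real.mul_rpow (abs_nonneg _) (norm_nonneg _),
      Real.mul_rpow (abs_nonneg _) hf]
    ring

lemma core_one (hd : 1 ≤ d) {δ K : ℝ} (hδ : 0 < δ) (hK : 0 ≤ K) :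
    ∃ γ N : ℝ, γ ∈ Set.Ioc (0:ℝ) 1 ∧ 0 < N ∧
      ∀ (a : Eu d → Matrix (Fin d) (Fin d) ℝ) (b : Eu d → Eu d) (c : Eu d → ℝ)
      (_ : Coef δ K a b c) (u : Eu d → ℝ) (du : Eu d → Eu d)
      (d2u : Eu d → Matrix (Fin d) (Fin d) ℝ) (_ : Adm u du d2u)
      (_ : ∫⁻ x in Metric.ball (0 : Eu d) 1, ENNReal.ofReal
        |(∑ i, ∑ j, a x i j * d2u x i j) + (∑ i, b x i * du x i) - c x * u x| ^ (d:ℝ) < 1)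
      (s : ℝ) (_ : s < 1) (_ : ∀ x ∈ Metric.sphere (0 : Eu d) 1, |u x| ≤ s),
      ∫⁻ x in Metric.ball (0 : Eu d) 1, ENNReal.ofReal ‖du x‖ ^ γ ≤ ENNReal.ofReal N := by
  obtain ⟨γ, N, hγ, hN, hsm⟩ := smooth_est hd hδ hK
  refine ⟨γ, N, hγ, hN, ?_⟩
  intro a b c hco u du d2u hu hLu s hs hus
  have huu := (isCompact_closedBall (0 : Eu d) 1).uniformContinuousOn_of_continuous hu.uc
  rw [Metric.uniformContinuousOn_iff] at huu
  obtain ⟨η, hη, huη⟩ := huu ((1 - s) / 2) (by linarith)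
  set q : ℝ := min (1 / 2) (η / 2) with hq
  have hq0 : 0 < q := by rw [hq]; positivity
  have hq1 : q ≤ 1 / 2 := min_le_left _ _
  have hq2 : q ≤ η / 2 := min_le_right _ _
  let R : ℕ → ℝ := fun n => 1 - q / (n + 1)
  have hqn : ∀ n : ℕ, 0 < q / (n + 1) ∧ q / (n + 1) ≤ q := by
    intro n
    refine ⟨by positivity, div_le_self hq0.le ?_⟩
    have : (0:ℝ) ≤ n := by positivity
    linarith
  have hRn : ∀ n, ∫⁻ x in Metric.ball (0 : Eu d) (R n), ENNReal.ofReal ‖du x‖ ^ γ ≤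
      ENNReal.ofReal N := by
    intro n
    have h3 := hqn n
    have hR1 : R n < 1 := by simp only [R]; linarith
    have hR2 : 1 / 2 ≤ R n := by simp only [R]; linarith
    have hRη : 1 - R n < η := by simp only [R]; linarith
    refine core_R hd hδ hK hγ.1 hco.sym hco.ell hco.bc hco.c0
      (hsm a b c hco.sym hco.ell hco.bc hco.c0) hco.am hco.bm hco.cm hu.um hu.dum hu.d2m hu.uc
      hu.h1 hu.h2 hu.int hLu hR2 hR1 (s := (1 + s) / 2) (by linarith) ?_
    intro x hx
    rw [mem_sphere_zero_iff_norm] at hx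
    have hR0 : 0 < R n := by linarith
    have hx' : (R n)⁻¹ • x ∈ Metric.sphere (0 : Eu d) 1 := by
      rw [mem_sphere_zero_iff_norm, norm_smul, hx, Real.norm_eq_abs, abs_of_pos (by positivity)]
      field_simp
    have hdist : dist x ((R n)⁻¹ • x) < η := by
      have e : x - (R n)⁻¹ • x = (1 - (R n)⁻¹) • x := by module
      rw [dist_eq_norm, e, norm_smul, hx, Real.norm_eq_abs, abs_of_nonpos, neg_mul, sub_mul,
        inv_mul_cancel₀ hR0.ne']
      · linarith
      · have := one_le_inv₀ hR0 |>.2 hR1.le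
        linarith
    have h5 := huη x (mem_closedBall_zero_iff.2 (by rw [hx]; exact hR1.le)) _
      (Metric.sphere_subset_closedBall hx') hdist
    rw [Real.dist_eq] at h5
    have h6 := hus _ hx'
    have h7 := abs_add_le (u x - u ((R n)⁻¹ • x)) (u ((R n)⁻¹ • x))
    rw [sub_add_cancel] at h7
    linarith
  have hmono : Monotone R := by
    intro m n hmn
    have hmn' : (m:ℝ) ≤ n := by exact_mod_cast hmn
    simp only [R]
    have : q / ((n:ℝ) + 1) ≤ q / ((m:ℝ) + 1) := by gcongr
    linarith
  have hun : Metric.ball (0 : Eu d) 1 = ⋃ n, Metric.ball (0 : Eu d) (R n) := by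
    ext x
    simp only [mem_iUnion, mem_ball_zero_iff]
    constructor
    · intro hx
      obtain ⟨n, hn⟩ := exists_nat_gt (q / (1 - ‖x‖))
      refine ⟨n, ?_⟩
      have h0 : 0 < 1 - ‖x‖ := by linarith
      rw [div_lt_iff₀ h0] at hn
      simp only [R]
      have h4 : q / ((n:ℝ) + 1) < 1 - ‖x‖ := by
        rw [div_lt_iff₀ (by positivity)]
        nlinarith
      linarith
    · rintro ⟨n, hn⟩
      have := (hqn n).1
      simp only [R] at hn
      linarith
  rw [hun, setLIntegral_iUnion_of_directed]
  · exact iSup_le hRn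
  · exact directed_of_isDirected_le fun m n hmn => Metric.ball_subset_ball (hmono hmn)

lemma le_biSup_sphere {u : Eu d → ℝ} (hu : ContinuousOn u (Metric.closedBall (0 : Eu d) 1))
    {x : Eu d} (hx : x ∈ Metric.sphere (0 : Eu d) 1) :
    |u x| ≤ ⨆ x ∈ Metric.sphere (0 : Eu d) 1, |u x| := by
  obtain ⟨B, hB⟩ := (isCompact_sphere (0 : Eu d) 1).exists_bound_of_continuousOn
    (hu.mono Metric.sphere_subset_closedBall)
  have hbdd : BddAbove (range fun x : Eu d => ⨆ _ : x ∈ Metric.sphere (0 : Eu d) 1, |u x|) := by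
    refine ⟨max B 0, ?_⟩
    rintro _ ⟨y, rfl⟩
    by_cases hy : y ∈ Metric.sphere (0 : Eu d) 1
    · simp only [hy, ciSup_unique]
      exact (hB y hy).trans (le_max_left _ _)
    · simp only [hy, Real.iSup_of_isEmpty]
      exact le_max_right _ _
  refine le_trans (le_of_eq ?_) (le_ciSup hbdd x)
  simp only [hx, ciSup_unique]

end

/-- **Theorem 2.2.** There are constants `γ ∈ (0,1]` and `N`, depending only on `δ`, `K`, `d`,
such that for any `L ∈ 𝔏_{δ,K}` with coefficients independent of `t`
(`Lu = aⁱʲD_{ij}u + bⁱDᵢu - cu`) and any `u ∈ W²_{d,loc}(B₁) ∩ C(B̄₁)` one has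
`∫_{B₁} |Du|^γ ≤ N sup_{∂B₁} |u|^γ + N (∫_{B₁} |Lu|^d)^{γ/d}`. -/
theorem elliptic_gradient_estimate
    (d : ℕ) (hd : 1 ≤ d) (δ K : ℝ) (hδ0 : 0 < δ) (hδ1 : δ < 1) (hK : 0 ≤ K) :
    ∃ γ N : ℝ, γ ∈ Set.Ioc (0 : ℝ) 1 ∧ 0 < N ∧
      ∀ (a : EuclideanSpace ℝ (Fin d) → Matrix (Fin d) (Fin d) ℝ)
        (b : EuclideanSpace ℝ (Fin d) → EuclideanSpace ℝ (Fin d))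
        (c : EuclideanSpace ℝ (Fin d) → ℝ)
        (u : EuclideanSpace ℝ (Fin d) → ℝ)
        (du : EuclideanSpace ℝ (Fin d) → EuclideanSpace ℝ (Fin d))
        (d2u : EuclideanSpace ℝ (Fin d) → Matrix (Fin d) (Fin d) ℝ),
        -- measurability of the coefficients of `L ∈ 𝔏_{δ,K}`
        (∀ i j, Measurable fun x => a x i j) →
        (∀ i, Measurable fun x => b x i) →
        Measurable c →
        -- `a` is `S_δ`-valued
        (∀ x, (a x).IsSymm) →
        (∀ x (ξ : EuclideanSpace ℝ (Fin d)),
          δ * ‖ξ‖ ^ 2 ≤ ∑ i, ∑ j, a x i j * ξ i * ξ j ∧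
          ∑ i, ∑ j, a x i j * ξ i * ξ j ≤ δ⁻¹ * ‖ξ‖ ^ 2) →
        -- `|b| + c ≤ K`, `c ≥ 0`
        (∀ x, ‖b x‖ + c x ≤ K) →
        (∀ x, 0 ≤ c x) →
        -- measurability
        Measurable u →
        (∀ i, Measurable fun x => du x i) →
        (∀ i j, Measurable fun x => d2u x i j) →
        -- `u ∈ C(B̄₁)`
        ContinuousOn u (Metric.closedBall (0 : EuclideanSpace ℝ (Fin d)) 1) →
        -- `du = Du`, `d2u = D²u` pointwise in `B₁`
        (∀ x ∈ Metric.ball (0 : EuclideanSpace ℝ (Fin d)) 1, ∀ i,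
          HasDerivAt (fun s : ℝ => u (x + s • EuclideanSpace.single i (1 : ℝ))) (du x i) 0) →
        (∀ x ∈ Metric.ball (0 : EuclideanSpace ℝ (Fin d)) 1, ∀ i j,
          HasDerivAt (fun s : ℝ => du (x + s • EuclideanSpace.single j (1 : ℝ)) i) (d2u x i j) 0) →
        -- `u ∈ W²_{d,loc}(B₁)`
        (∀ G : Set (EuclideanSpace ℝ (Fin d)), IsCompact G →
          G ⊆ Metric.ball (0 : EuclideanSpace ℝ (Fin d)) 1 →
          IntegrableOn (fun x => |u x| ^ (d : ℝ) + ‖du x‖ ^ (d : ℝ) + frobNorm (d2u x) ^ (d : ℝ))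
            G volume) →
        (∫⁻ x in Metric.ball (0 : EuclideanSpace ℝ (Fin d)) 1,
            ENNReal.ofReal (‖du x‖) ^ γ ∂volume)
          ≤ ENNReal.ofReal N *
              (∫⁻ x in Metric.ball (0 : EuclideanSpace ℝ (Fin d)) 1,
                ENNReal.ofReal
                  |(∑ i, ∑ j, a x i j * d2u x i j) + (∑ i, b x i * du x i) - c x * u x|
                  ^ (d : ℝ) ∂volume) ^ (γ / (d : ℝ))
            + ENNReal.ofReal N *
              ENNReal.ofReal
                ((⨆ x ∈ Metric.sphere (0 : EuclideanSpace ℝ (Fin d)) 1, |u x|) ^ γ) := by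
  obtain ⟨γ, N, hγ, hN, hcore⟩ := core_one hd hδ0 hK
  refine ⟨γ, N, hγ, hN, ?_⟩
  intro a b c u du d2u ham hbm hcm hsym hell hbc hc0 hum hdum hd2m huc h1 h2 hInteg
  have hco : Coef δ K a b c := ⟨ham, hbm, hcm, hsym, hell, hbc, hc0⟩
  have hu : Adm u du d2u := ⟨hum, hdum, hd2m, huc, h1, h2, hInteg⟩
  have hd0 : (0:ℝ) < d := by exact_mod_cast hd
  set S : ℝ := ⨆ x ∈ Metric.sphere (0 : EuclideanSpace ℝ (Fin d)) 1, |u x| with hS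
  have hS0 : 0 ≤ S := Real.iSup_nonneg fun x => Real.iSup_nonneg fun _ => abs_nonneg _
  set f : EuclideanSpace ℝ (Fin d) → ℝ := fun x =>
    (∑ i, ∑ j, a x i j * d2u x i j) + (∑ i, b x i * du x i) - c x * u x with hf
  change _ ≤ ENNReal.ofReal N * (∫⁻ x in Metric.ball (0 : EuclideanSpace ℝ (Fin d)) 1,
    ENNReal.ofReal |f x| ^ (d : ℝ)) ^ (γ / (d : ℝ)) + _
  set I : ℝ≥0∞ := ∫⁻ x in Metric.ball (0 : EuclideanSpace ℝ (Fin d)) 1,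
    ENNReal.ofReal |f x| ^ (d : ℝ) with hI
  have hγd : 0 < γ / (d:ℝ) := div_pos hγ.1 hd0
  by_cases hIt : I = ⊤
  · rw [hIt, ENNReal.top_rpow_of_pos hγd, ENNReal.mul_top (by simpa using hN), top_add]
    exact le_top
  set m : ℝ := I.toReal ^ (1 / (d:ℝ)) with hm
  have hm0 : 0 ≤ m := by positivity
  have hIm : I = ENNReal.ofReal m ^ (d:ℝ) := by
    rw [ENNReal.ofReal_rpow_of_nonneg hm0 hd0.le, hm, ← Real.rpow_mul ENNReal.toReal_nonneg,
      one_div, inv_mul_cancel₀ hd0.ne', Real.rpow_one, ENNReal.ofReal_toReal hIt]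
  have key : ∀ ε > 0, (∫⁻ x in Metric.ball (0 : EuclideanSpace ℝ (Fin d)) 1,
      ENNReal.ofReal (‖du x‖) ^ γ) ≤ ENNReal.ofReal (N * (S + m + ε) ^ γ) := by
    intro ε hε
    set κ : ℝ := S + m + ε with hκ
    have hκ0 : 0 < κ := by positivity
    have h3 := hcore a b c hco _ _ _ (hu.scale κ⁻¹) (by
      have e1 : ∀ x, ENNReal.ofReal |(∑ i, ∑ j, a x i j * (κ⁻¹ • d2u x) i j) +
          (∑ i, b x i * (κ⁻¹ • du x) i) - c x * (κ⁻¹ * u x)| ^ (d:ℝ) =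
          ENNReal.ofReal κ⁻¹ ^ (d:ℝ) * ENNReal.ofReal |f x| ^ (d:ℝ) := by
        intro x
        have e2 : (∑ i, ∑ j, a x i j * (κ⁻¹ • d2u x) i j) +
          (∑ i, b x i * (κ⁻¹ • du x) i) - c x * (κ⁻¹ * u x) = κ⁻¹ * f x := by
          simp only [hf, Matrix.smul_apply, PiLp.smul_apply, smul_eq_mul, mul_sub, mul_add,
            Finset.mul_sum]
          simp only [mul_left_comm]
        rw [e2, abs_mul, abs_of_pos (inv_pos.2 hκ0), ENNReal.ofReal_mul (inv_pos.2 hκ0).le,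
          ENNReal.mul_rpow_of_nonneg _ _ hd0.le]
      simp only [e1]
      rw [lintegral_const_mul' _ _ (ENNReal.rpow_ne_top_of_nonneg hd0.le ENNReal.ofReal_ne_top),
        ← hI, hIm, ← ENNReal.mul_rpow_of_nonneg _ _ hd0.le,
        ← ENNReal.ofReal_mul (inv_pos.2 hκ0).le]
      refine ENNReal.rpow_lt_one ?_ hd0
      rw [ENNReal.ofReal_lt_one, inv_mul_lt_iff₀ hκ0]
      linarith) (κ⁻¹ * S) (by rw [inv_mul_lt_iff₀ hκ0]; linarith) (by
      intro x hx
      rw [abs_mul, abs_of_pos (inv_pos.2 hκ0)]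
      exact mul_le_mul_of_nonneg_left (le_biSup_sphere huc hx) (inv_pos.2 hκ0).le)
    have e3 : ∀ x, ENNReal.ofReal ‖du x‖ ^ γ =
        ENNReal.ofReal (κ ^ γ) * ENNReal.ofReal ‖κ⁻¹ • du x‖ ^ γ := by
      intro x
      rw [← ENNReal.ofReal_rpow_of_nonneg hκ0.le hγ.1.le,
        ← ENNReal.mul_rpow_of_nonneg _ _ hγ.1.le, ← ENNReal.ofReal_mul hκ0.le, norm_smul,
        Real.norm_eq_abs, abs_of_pos (inv_pos.2 hκ0), mul_inv_cancel_left₀ hκ0.ne']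
    simp only [e3]
    rw [lintegral_const_mul' _ _ ENNReal.ofReal_ne_top, mul_comm N,
      ENNReal.ofReal_mul (Real.rpow_nonneg hκ0.le _)]
    exact mul_le_mul_right h3 _
  have hlim : Filter.Tendsto (fun ε : ℝ => ENNReal.ofReal (N * (S + m + ε) ^ γ))
      (nhdsWithin 0 (Ioi 0)) (nhds (ENNReal.ofReal (N * (S + m + 0) ^ γ))) := by
    apply ENNReal.tendsto_ofReal
    apply Filter.Tendsto.const_mul
    have hc : Continuous fun ε : ℝ => (S + m + ε) ^ γ :=
      (continuous_const.add continuous_id).rpow_const fun _ => Or.inr hγ.1.le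
    exact hc.continuousAt.tendsto.mono_left nhdsWithin_le_nhds
  have h4 := ge_of_tendsto hlim (Filter.eventually_of_mem self_mem_nhdsWithin key)
  refine h4.trans ?_
  rw [add_zero]
  have h5 : (S + m) ^ γ ≤ S ^ γ + m ^ γ := Real.rpow_add_le_add_rpow hS0 hm0 hγ.1.le hγ.2
  have h6 : I ^ (γ / (d:ℝ)) = ENNReal.ofReal (m ^ γ) := by
    rw [hIm, ← ENNReal.rpow_mul, mul_div_cancel₀ _ hd0.ne',
      ENNReal.ofReal_rpow_of_nonneg hm0 hγ.1.le]
  rw [h6, ← ENNReal.ofReal_mul hN.le, ← ENNReal.ofReal_mul hN.le,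
    ← ENNReal.ofReal_add (by positivity) (by positivity)]
  apply ENNReal.ofReal_le_ofReal
  nlinarith
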